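/- arXiv:1809.02015 — 2 statements merged into one kernel-verified Lean document; each statement's English description precedes it below -/
import Mathlib

section
/- Let 1/2 < γ < 1 and let v : [0,1] → ℝ be continuous with v(1) = 0 and with finite Gagliardo H^γ(0,1) norm. Then there exists w ∈ L²(0,1) with ‖w‖_{L²(0,1)} ≤ C_γ ‖v‖_{H^γ(0,1)}, where C_γ depends only on γ, such that (I_{1-}^{1-γ} v)(t) = ∫_t^1 w(s) ds for almost every t ∈ (0,1); that is, the right Riemann–Liouville derivative D_{1-}^γ v = −(d/dt) I_{1-}^{1-γ} v exists in L²(0,1) and satisfies ‖D_{1-}^γ v‖_{L²(0,1)} ≤ C_γ ‖v‖_{H^γ(0,1)}. -/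
open MeasureTheory

/-- Right Riemann–Liouville fractional integral on `(0,1)`:
`(I_{1-}^γ v)(t) = (1/Γ(γ)) ∫_t^1 (s-t)^(γ-1) v(s) ds`. -/
noncomputable def rightFracInt (γ : ℝ) (v : ℝ → ℝ) (t : ℝ) : ℝ :=
  (Real.Gamma γ)⁻¹ * ∫ s in t..(1 : ℝ), (s - t) ^ (γ - 1) * v s

/-- Gagliardo seminorm `[v]_{H^γ(0,1)}`. -/
noncomputable def gagliardoSemi (γ : ℝ) (v : ℝ → ℝ) : ℝ :=
  Real.sqrt (∫ s in Set.Ioo (0 : ℝ) 1, ∫ t in Set.Ioo (0 : ℝ) 1,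
    (v s - v t) ^ 2 / |s - t| ^ (1 + 2 * γ))

/-- The `H^γ(0,1)` norm `(‖v‖²_{L²(0,1)} + [v]²_{H^γ(0,1)})^(1/2)`. -/
noncomputable def sobNorm (γ : ℝ) (v : ℝ → ℝ) : ℝ :=
  Real.sqrt ((∫ s in Set.Ioo (0 : ℝ) 1, (v s) ^ 2) + (gagliardoSemi γ v) ^ 2)


noncomputable def zf (g : ℝ → ℝ) (l t : ℝ) : ℝ := ∫ r in (0:ℝ)..t, Real.exp (-l * (t - r)) * g r
noncomputable def qf (g : ℝ → ℝ) (l t : ℝ) : ℝ :=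
  ∫ r in (0:ℝ)..t, (t - r) * Real.exp (-l * (t - r)) * g r

lemma zf_cont {g : ℝ → ℝ} (hg : Continuous g) : Continuous (fun p : ℝ × ℝ => zf g p.1 p.2) := by
  unfold zf
  apply intervalIntegral.continuous_parametric_intervalIntegral_of_continuous
    (f := fun p : ℝ × ℝ => fun r => Real.exp (-p.1 * (p.2 - r)) * g r)
  · simp only [Function.uncurry_def]; fun_prop
  · fun_prop

lemma qf_cont {g : ℝ → ℝ} (hg : Continuous g) : Continuous (fun p : ℝ × ℝ => qf g p.1 p.2) := by
  unfold qf
  apply intervalIntegral.continuous_parametric_intervalIntegral_of_continuous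
    (f := fun p : ℝ × ℝ => fun r => (p.2 - r) * Real.exp (-p.1 * (p.2 - r)) * g r)
  · simp only [Function.uncurry_def]; fun_prop
  · fun_prop

lemma zf_deriv {g : ℝ → ℝ} (hg : Continuous g) (l t : ℝ) :
    HasDerivAt (zf g l) (g t - l * zf g l t) t := by
  have e : ∀ t, zf g l t = Real.exp (-l * t) * ∫ r in (0:ℝ)..t, Real.exp (l * r) * g r := by
    intro t
    rw [zf, ← intervalIntegral.integral_const_mul]
    congr 1; ext r
    rw [← mul_assoc, ← Real.exp_add]; ring_nf
  have h1 : HasDerivAt (fun t => ∫ r in (0:ℝ)..t, Real.exp (l * r) * g r)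
      (Real.exp (l * t) * g t) t := by
    have hc : Continuous (fun r => Real.exp (l * r) * g r) := by fun_prop
    exact intervalIntegral.integral_hasDerivAt_right (hc.intervalIntegrable _ _)
      (hc.stronglyMeasurableAtFilter _ _) hc.continuousAt
  have h2 : HasDerivAt (fun t => Real.exp (-l * t)) (Real.exp (-l * t) * (-l)) t := by
    have := ((hasDerivAt_id t).const_mul (-l)).exp
    simpa using this
  have h3 := h2.mul h1
  have : zf g l = (fun t => Real.exp (-l * t)) * fun t => ∫ r in (0:ℝ)..t, Real.exp (l * r) * g r :=
    funext e
  rw [e t, this]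
  refine HasDerivAt.congr_deriv h3 ?_
  have : Real.exp (-l * t) * (Real.exp (l * t) * g t) = g t := by
    rw [← mul_assoc, ← Real.exp_add]; simp
  rw [this]; ring

lemma qf_deriv {g : ℝ → ℝ} (hg : Continuous g) (l t : ℝ) :
    HasDerivAt (qf g l) (zf g l t - l * qf g l t) t := by
  have hid : Continuous (fun r => r * g r) := by fun_prop
  have e : ∀ t, qf g l t = t * zf g l t - zf (fun r => r * g r) l t := by
    intro t
    rw [qf, zf, zf, ← intervalIntegral.integral_const_mul, ← intervalIntegral.integral_sub]
    · congr 1; ext r; ring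
    · exact Continuous.intervalIntegrable (by fun_prop) _ _
    · exact Continuous.intervalIntegrable (by fun_prop) _ _
  have h := ((hasDerivAt_id t).mul (zf_deriv hg l t)).sub (zf_deriv hid l t)
  have e' : qf g l = id * zf g l - zf (fun r => r * g r) l := funext e
  rw [e t, e']
  refine HasDerivAt.congr_deriv h ?_
  simp; ring

lemma zf_deriv_l {g : ℝ → ℝ} (hg : Continuous g) (l t : ℝ) :
    HasDerivAt (fun l => zf g l t) (- qf g l t) l := by
  have key := intervalIntegral.hasDerivAt_integral_of_dominated_loc_of_deriv_le (μ := volume)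
    (a := 0) (b := t)
    (F := fun l r => Real.exp (-l * (t - r)) * g r)
    (F' := fun l r => -((t - r) * Real.exp (-l * (t - r)) * g r)) (x₀ := l)
    (s := Set.Icc (l-1) (l+1))
    (bound := fun r => |t - r| * Real.exp ((|l|+1) * |t - r|) * |g r|)
    (Icc_mem_nhds (by linarith) (by linarith))
    (Filter.Eventually.of_forall fun x => Continuous.aestronglyMeasurable (by fun_prop))
    (Continuous.intervalIntegrable (by fun_prop) _ _)
    (Continuous.aestronglyMeasurable (by fun_prop))
    (Filter.Eventually.of_forall fun r _ x hx => by
      rw [norm_neg, norm_mul, norm_mul]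
      simp only [Real.norm_eq_abs, Real.abs_exp]
      refine mul_le_mul_of_nonneg_right (mul_le_mul_of_nonneg_left (Real.exp_le_exp.2 ?_)
        (abs_nonneg _)) (abs_nonneg _)
      have : |x| ≤ |l| + 1 := by
        rw [abs_le]; constructor <;> cases abs_cases l <;> linarith [hx.1, hx.2]
      calc -x * (t - r) ≤ |-x * (t-r)| := le_abs_self _
        _ = |x| * |t - r| := by rw [abs_mul, abs_neg]
        _ ≤ _ := by gcongr)
    (Continuous.intervalIntegrable (by fun_prop) _ _)
    (Filter.Eventually.of_forall fun r _ x hx => by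
      have := (((hasDerivAt_id x).neg.mul_const (t - r)).exp).mul_const (g r)
      refine HasDerivAt.congr_deriv this ?_
      simp; ring)
  have := key.2
  rw [intervalIntegral.integral_neg] at this
  exact this

lemma uq_bound {g : ℝ → ℝ} (hg : Continuous g) {l : ℝ} (hl : 0 < l) :
    ∫ t in (0:ℝ)..1, l * qf g l t ^ 2 ≤
      ∫ t in (0:ℝ)..1, ((∫ r in (0:ℝ)..t, g r) - zf g l t) * qf g l t := by
  have hφ : ∀ t, HasDerivAt (fun t => ∫ r in (0:ℝ)..t, g r) (g t) t := fun t =>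
    intervalIntegral.integral_hasDerivAt_right (hg.intervalIntegrable _ _)
      (hg.stronglyMeasurableAtFilter _ _) hg.continuousAt
  have hφc : Continuous (fun t => ∫ r in (0:ℝ)..t, g r) :=
    continuous_iff_continuousAt.2 fun t => (hφ t).continuousAt
  have hzc : Continuous (zf g l) := (zf_cont hg).comp (by fun_prop : Continuous fun t : ℝ => (l, t))
  have hqc : Continuous (qf g l) := (qf_cont hg).comp (by fun_prop : Continuous fun t : ℝ => (l, t))
  set Y : ℝ → ℝ := fun t => (∫ r in (0:ℝ)..t, g r) - zf g l t - l * qf g l t with hY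
  have hYd : ∀ t, HasDerivAt Y (l^2 * qf g l t) t := by
    intro t
    have := ((hφ t).sub (zf_deriv hg l t)).sub ((qf_deriv hg l t).const_mul l)
    refine HasDerivAt.congr_deriv this ?_; ring
  have hYc : Continuous Y := by fun_prop
  have hY0 : Y 0 = 0 := by simp [hY, zf, qf]
  have h2 : ∫ t in (0:ℝ)..1, Y t * qf g l t = Y 1 ^ 2 / (2 * l^2) := by
    have : ∀ t, HasDerivAt (fun t => Y t ^ 2 / (2 * l ^ 2)) (Y t * qf g l t) t := by
      intro t
      have := ((hYd t).pow 2).div_const (2 * l^2)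
      refine HasDerivAt.congr_deriv this ?_
      field_simp; norm_num; try ring
    rw [intervalIntegral.integral_eq_sub_of_hasDerivAt (fun t _ => this t)
      (Continuous.intervalIntegrable (by fun_prop) _ _)]
    simp [hY0]
  have h3 : ∫ t in (0:ℝ)..1, ((∫ r in (0:ℝ)..t, g r) - zf g l t) * qf g l t =
      (∫ t in (0:ℝ)..1, l * qf g l t ^ 2) + ∫ t in (0:ℝ)..1, Y t * qf g l t := by
    rw [← intervalIntegral.integral_add]
    · congr 1; ext t; simp only [hY]; ring
    · exact Continuous.intervalIntegrable (by fun_prop) _ _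
    · exact Continuous.intervalIntegrable (by fun_prop) _ _
  rw [h3, h2]
  have : 0 ≤ Y 1 ^ 2 / (2 * l^2) := by positivity
  linarith

lemma u_bound {g : ℝ → ℝ} (hg : Continuous g) {l : ℝ} (hl : 0 < l) :
    ∫ t in (0:ℝ)..1, ((∫ r in (0:ℝ)..t, g r) - zf g l t) ^ 2 ≤
      ∫ t in (0:ℝ)..1, (∫ r in (0:ℝ)..t, g r) ^ 2 := by
  have hφ : ∀ t, HasDerivAt (fun t => ∫ r in (0:ℝ)..t, g r) (g t) t := fun t =>
    intervalIntegral.integral_hasDerivAt_right (hg.intervalIntegrable _ _)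
      (hg.stronglyMeasurableAtFilter _ _) hg.continuousAt
  have hφc : Continuous (fun t => ∫ r in (0:ℝ)..t, g r) :=
    continuous_iff_continuousAt.2 fun t => (hφ t).continuousAt
  have hzc : Continuous (zf g l) := (zf_cont hg).comp (by fun_prop : Continuous fun t : ℝ => (l, t))
  set φ : ℝ → ℝ := fun t => ∫ r in (0:ℝ)..t, g r with hφdef
  set u : ℝ → ℝ := fun t => φ t - zf g l t with hu
  have hud : ∀ t, HasDerivAt u (l * (φ t - u t)) t := by
    intro t
    have := ((hφ t).sub (zf_deriv hg l t))
    refine HasDerivAt.congr_deriv this ?_; simp only [hu]; ring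
  have huc : Continuous u := by fun_prop
  have hu0 : u 0 = 0 := by simp [hu, hφdef, zf]
  have h2 : ∫ t in (0:ℝ)..1, u t * (φ t - u t) = u 1 ^ 2 / (2 * l) := by
    have : ∀ t, HasDerivAt (fun t => u t ^ 2 / (2 * l)) (u t * (φ t - u t)) t := by
      intro t
      have := ((hud t).pow 2).div_const (2 * l)
      refine HasDerivAt.congr_deriv this ?_
      field_simp; norm_num; try ring
    rw [intervalIntegral.integral_eq_sub_of_hasDerivAt (fun t _ => this t)
      (Continuous.intervalIntegrable (by fun_prop) _ _)]
    simp [hu0]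
  have h3 : ∫ t in (0:ℝ)..1, φ t ^ 2 = (∫ t in (0:ℝ)..1, u t ^ 2)
      + (2 * (∫ t in (0:ℝ)..1, u t * (φ t - u t)) + ∫ t in (0:ℝ)..1, (φ t - u t) ^ 2) := by
    rw [← intervalIntegral.integral_const_mul, ← intervalIntegral.integral_add,
      ← intervalIntegral.integral_add]
    · congr 1; ext t; ring
    all_goals exact Continuous.intervalIntegrable (by fun_prop) _ _
  have h4 : 0 ≤ ∫ t in (0:ℝ)..1, (φ t - u t) ^ 2 :=
    intervalIntegral.integral_nonneg (by norm_num) fun t _ => sq_nonneg _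
  have : 0 ≤ u 1 ^ 2 / (2 * l) := by positivity
  change ∫ t in (0:ℝ)..1, u t ^ 2 ≤ ∫ t in (0:ℝ)..1, φ t ^ 2
  rw [h3, h2]
  linarith

lemma swap_cont {f : ℝ → ℝ → ℝ} (hf : Continuous (Function.uncurry f)) {a b c d : ℝ}
    (hab : a ≤ b) (hcd : c ≤ d) :
    ∫ x in a..b, ∫ y in c..d, f x y = ∫ y in c..d, ∫ x in a..b, f x y := by
  simp only [intervalIntegral.integral_of_le hab, intervalIntegral.integral_of_le hcd]
  apply integral_integral_swap
  rw [Measure.prod_restrict]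
  have : IntegrableOn (Function.uncurry f) (Set.Icc a b ×ˢ Set.Icc c d) :=
    hf.continuousOn.integrableOn_compact (isCompact_Icc.prod isCompact_Icc)
  exact this.mono_set (Set.prod_mono Set.Ioc_subset_Icc_self Set.Ioc_subset_Icc_self)

lemma square_fn {g : ℝ → ℝ} (hg : Continuous g) {L : ℝ} (hL : 0 < L) :
    ∫ l in (0:ℝ)..L, ∫ t in (0:ℝ)..1, l * qf g l t ^ 2 ≤
      (1 / 2) * ∫ t in (0:ℝ)..1, (∫ r in (0:ℝ)..t, g r) ^ 2 := by
  have hφ : ∀ t, HasDerivAt (fun t => ∫ r in (0:ℝ)..t, g r) (g t) t := fun t =>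
    intervalIntegral.integral_hasDerivAt_right (hg.intervalIntegrable _ _)
      (hg.stronglyMeasurableAtFilter _ _) hg.continuousAt
  have hφc : Continuous (fun t => ∫ r in (0:ℝ)..t, g r) :=
    continuous_iff_continuousAt.2 fun t => (hφ t).continuousAt
  have hzc := zf_cont hg
  have hqc := qf_cont hg
  set φ : ℝ → ℝ := fun t => ∫ r in (0:ℝ)..t, g r with hφdef
  have c1 : Continuous (Function.uncurry fun l t => l * qf g l t ^ 2) := by
    simp only [Function.uncurry_def]; fun_prop
  have c2 : Continuous (Function.uncurry fun l t => (φ t - zf g l t) * qf g l t) := by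
    simp only [Function.uncurry_def]; fun_prop
  calc ∫ l in (0:ℝ)..L, ∫ t in (0:ℝ)..1, l * qf g l t ^ 2
      ≤ ∫ l in (0:ℝ)..L, ∫ t in (0:ℝ)..1, (φ t - zf g l t) * qf g l t := by
        apply intervalIntegral.integral_mono_on_of_le_Ioo hL.le
        · exact (intervalIntegral.continuous_parametric_intervalIntegral_of_continuous' c1 0 1).intervalIntegrable _ _
        · exact (intervalIntegral.continuous_parametric_intervalIntegral_of_continuous' c2 0 1).intervalIntegrable _ _
        · intro l hl
          exact uq_bound hg hl.1
    _ = ∫ t in (0:ℝ)..1, ∫ l in (0:ℝ)..L, (φ t - zf g l t) * qf g l t :=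
        swap_cont c2 hL.le zero_le_one
    _ = ∫ t in (0:ℝ)..1, ((φ t - zf g L t) ^ 2 / 2 - (φ t - zf g 0 t) ^ 2 / 2) := by
        congr 1; ext t
        apply intervalIntegral.integral_eq_sub_of_hasDerivAt (f := fun l => (φ t - zf g l t) ^ 2 / 2)
        · intro l _
          have := (((hasDerivAt_const l (φ t)).sub (zf_deriv_l hg l t)).pow 2).div_const 2
          refine HasDerivAt.congr_deriv this ?_
          simp; try ring
        · exact Continuous.intervalIntegrable
            (c2.comp (by fun_prop : Continuous fun l : ℝ => (l, t))) _ _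
    _ ≤ ∫ t in (0:ℝ)..1, (1/2) * (φ t - zf g L t) ^ 2 := by
        have hL' : Continuous (zf g L) := hzc.comp (by fun_prop : Continuous fun t : ℝ => (L, t))
        have h0' : Continuous (zf g 0) := hzc.comp (by fun_prop : Continuous fun t : ℝ => ((0:ℝ), t))
        apply intervalIntegral.integral_mono_on zero_le_one
        · exact Continuous.intervalIntegrable (by fun_prop) _ _
        · exact Continuous.intervalIntegrable (by fun_prop) _ _
        · intro t _
          nlinarith [sq_nonneg (φ t - zf g 0 t)]
    _ ≤ _ := by
        rw [intervalIntegral.integral_const_mul]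
        have := u_bound hg hL
        gcongr

lemma cs_lint {α : Type*} [MeasurableSpace α] (μ : Measure α) {f g : α → ENNReal}
    (hf : AEMeasurable f μ) (hg : AEMeasurable g μ) :
    (∫⁻ x, f x * g x ∂μ) ^ 2 ≤ (∫⁻ x, f x ^ 2 ∂μ) * ∫⁻ x, g x ^ 2 ∂μ := by
  have h := ENNReal.lintegral_mul_le_Lp_mul_Lq μ Real.HolderConjugate.two_two hf hg
  calc (∫⁻ x, f x * g x ∂μ) ^ 2 ≤ ((∫⁻ x, f x ^ (2:ℝ) ∂μ) ^ (1 / (2:ℝ)) * (∫⁻ x, g x ^ (2:ℝ) ∂μ) ^ (1 / (2:ℝ))) ^ 2 := by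
        gcongr; exact h
    _ = _ := by
        rw [mul_pow]
        have e : ∀ a : ENNReal, (a ^ (1 / (2:ℝ))) ^ 2 = a := by
          intro a
          rw [← ENNReal.rpow_natCast, ← ENNReal.rpow_mul]; norm_num
        rw [e, e]
        simp

lemma cs_real {α : Type*} [MeasurableSpace α] (μ : Measure α) {a b : α → ℝ}
    (ha : AEMeasurable a μ) (hb : AEMeasurable b μ) :
    ENNReal.ofReal ((∫ x, a x * b x ∂μ) ^ 2) ≤
      (∫⁻ x, ENNReal.ofReal (a x ^ 2) ∂μ) * ∫⁻ x, ENNReal.ofReal (b x ^ 2) ∂μ := by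
  have e : ∀ x : ℝ, ENNReal.ofReal (x ^ 2) = ‖x‖ₑ ^ 2 := by
    intro x
    rw [Real.enorm_eq_ofReal_abs, ← ENNReal.ofReal_pow (abs_nonneg _), sq_abs]
  simp only [e]
  refine le_trans ?_ (cs_lint μ ha.enorm hb.enorm)
  gcongr
  refine (enorm_integral_le_lintegral_enorm _).trans_eq ?_
  simp [enorm_mul]

lemma tri_swap {A B : ℝ → ENNReal} (hA : Measurable A) (hB : Measurable B) :
    ∫⁻ x in Set.Ioo (0:ℝ) 1, A x * ∫⁻ y in Set.Ioo 0 x, B y =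
      ∫⁻ y in Set.Ioo (0:ℝ) 1, B y * ∫⁻ x in Set.Ioo y 1, A x := by
  have h1 : ∀ x ∈ Set.Ioo (0:ℝ) 1, A x * ∫⁻ y in Set.Ioo 0 x, B y =
      ∫⁻ y in Set.Ioo (0:ℝ) 1, (Set.indicator {p : ℝ × ℝ | p.2 < p.1} (fun p => A p.1 * B p.2) (x, y)) := by
    intro x hx
    rw [← lintegral_const_mul _ hB]
    have : Set.Ioo (0:ℝ) x = Set.Ioo 0 1 ∩ Set.Iio x := by
      ext y; simp; intro _ h; linarith [hx.2]
    rw [this, Set.inter_comm, ← Measure.restrict_restrict measurableSet_Iio,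
      ← lintegral_indicator measurableSet_Iio]
    rfl
  have h2 : ∀ y ∈ Set.Ioo (0:ℝ) 1, B y * ∫⁻ x in Set.Ioo y 1, A x =
      ∫⁻ x in Set.Ioo (0:ℝ) 1, (Set.indicator {p : ℝ × ℝ | p.2 < p.1} (fun p => A p.1 * B p.2) (x, y)) := by
    intro y hy
    rw [← lintegral_const_mul _ hA]
    have : Set.Ioo y 1 = Set.Ioo 0 1 ∩ Set.Ioi y := by
      ext x; simp; constructor
      · rintro ⟨h, h'⟩; exact ⟨⟨by linarith [hy.1], h'⟩, h⟩
      · rintro ⟨⟨h, h'⟩, h''⟩; exact ⟨h'', h'⟩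
    rw [this, Set.inter_comm, ← Measure.restrict_restrict measurableSet_Ioi,
      ← lintegral_indicator measurableSet_Ioi]
    refine lintegral_congr fun x => ?_
    simp [Set.indicator_apply, mul_comm]
  rw [setLIntegral_congr_fun measurableSet_Ioo h1, setLIntegral_congr_fun measurableSet_Ioo h2]
  apply lintegral_lintegral_swap
  apply Measurable.aemeasurable
  apply Measurable.indicator
  · fun_prop
  · exact measurableSet_lt measurable_snd measurable_fst

lemma hardy {γ : ℝ} (h1 : 1 / 2 < γ) {f : ℝ → ℝ} (hf : Continuous f) (h0 : f 0 = 0) :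
    ∫⁻ x in Set.Ioo (0:ℝ) 1, ENNReal.ofReal (f x ^ 2 * x ^ (-2 * γ)) ≤
      ENNReal.ofReal (2 + 2 / (γ - 1/2) ^ 2) * ∫⁻ x in Set.Ioo (0:ℝ) 1, ∫⁻ y in Set.Ioo (0:ℝ) 1,
        ENNReal.ofReal ((f x - f y) ^ 2 / |x - y| ^ (1 + 2 * γ)) := by
  set b := γ - 1/2 with hb
  have hb0 : 0 < b := by linarith
  have hP : ∀ t, HasDerivAt (fun t => ∫ r in (0:ℝ)..t, f r) (f t) t := fun t =>
    intervalIntegral.integral_hasDerivAt_right (hf.intervalIntegrable _ _)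
      (hf.stronglyMeasurableAtFilter _ _) hf.continuousAt
  have hPc : Continuous (fun t => ∫ r in (0:ℝ)..t, f r) :=
    continuous_iff_continuousAt.2 fun t => (hP t).continuousAt
  set m : ℝ → ℝ := fun x => x⁻¹ * ∫ r in (0:ℝ)..x, f r with hm
  have hmm : Measurable m := by fun_prop
  set d : ℝ → ℝ := fun x => f x - m x with hd
  have hdm : Measurable d := by fun_prop
  -- the oscillation part
  have B1 : ∀ x ∈ Set.Ioo (0:ℝ) 1, ENNReal.ofReal (d x ^ 2 * x ^ (-2 * γ)) ≤
      ∫⁻ y in Set.Ioo (0:ℝ) 1, ENNReal.ofReal ((f x - f y) ^ 2 / |x - y| ^ (1 + 2 * γ)) := by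
    intro x hx
    have hx0 := hx.1
    have e1 : ∫ y in (0:ℝ)..x, (f x - f y) = x * d x := by
      rw [intervalIntegral.integral_sub (by simp) (hf.intervalIntegrable _ _)]
      simp only [hd, hm, intervalIntegral.integral_const, smul_eq_mul]
      field_simp
      ring
    have e2 : x * d x ^ 2 ≤ ∫ y in (0:ℝ)..x, (f x - f y) ^ 2 := by
      have : 0 ≤ ∫ y in (0:ℝ)..x, (f x - f y - d x) ^ 2 :=
        intervalIntegral.integral_nonneg hx0.le fun _ _ => sq_nonneg _
      have e3 : ∫ y in (0:ℝ)..x, (f x - f y - d x) ^ 2 = (∫ y in (0:ℝ)..x, (f x - f y) ^ 2)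
          - 2 * d x * (∫ y in (0:ℝ)..x, (f x - f y)) + ∫ y in (0:ℝ)..x, d x ^ 2 := by
        rw [← intervalIntegral.integral_const_mul, ← intervalIntegral.integral_sub,
          ← intervalIntegral.integral_add]
        · congr 1; ext y; ring
        all_goals exact Continuous.intervalIntegrable (by fun_prop) _ _
      rw [e3, e1] at this
      simp only [intervalIntegral.integral_const, smul_eq_mul] at this
      nlinarith
    have e4 : d x ^ 2 * x ^ (-2 * γ) ≤ ∫ y in (0:ℝ)..x, (f x - f y) ^ 2 * x ^ (-(1 + 2 * γ)) := by
      rw [intervalIntegral.integral_mul_const]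
      have : x ^ (-2 * γ) = x * x ^ (-(1 + 2 * γ)) := by
        rw [← Real.rpow_one_add' hx0.le (by linarith)]; congr 1; ring
      rw [this]
      have := mul_le_mul_of_nonneg_right e2 (Real.rpow_nonneg hx0.le (-(1 + 2 * γ)))
      linarith
    refine (ENNReal.ofReal_le_ofReal e4).trans ?_
    have hc : Continuous fun y => (f x - f y) ^ 2 * x ^ (-(1 + 2 * γ)) := by fun_prop
    rw [intervalIntegral.integral_of_le hx0.le, integral_Ioc_eq_integral_Ioo,
      ofReal_integral_eq_lintegral_ofReal]
    · refine le_trans ?_ (lintegral_mono_set (Set.Ioo_subset_Ioo_right hx.2.le))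
      refine setLIntegral_mono' measurableSet_Ioo fun y hy => ?_
      apply ENNReal.ofReal_le_ofReal
      rw [div_eq_mul_inv, ← Real.rpow_neg (abs_nonneg _)]
      refine mul_le_mul_of_nonneg_left ?_ (sq_nonneg _)
      have : 0 < x - y := by linarith [hy.2]
      rw [abs_of_pos this]
      exact Real.rpow_le_rpow_of_nonpos this (by linarith [hy.1]) (by linarith)
    · exact (hc.integrableOn_Icc (a := 0) (b := x)).mono_set Set.Ioo_subset_Icc_self
    · exact Filter.Eventually.of_forall fun y => by positivity
  -- the mean part
  have B2 : ∀ x ∈ Set.Ioo (0:ℝ) 1, ENNReal.ofReal (m x ^ 2) ≤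
      ENNReal.ofReal (x ^ b / b) * ∫⁻ y in Set.Ioo (0:ℝ) x, ENNReal.ofReal (d y ^ 2 * y ^ (-1-b)) := by
    intro x hx
    have hx0 := hx.1
    have hm0 : Filter.Tendsto m (nhdsWithin 0 (Set.Ioi 0)) (nhds 0) := by
      have := (hasDerivAt_iff_tendsto_slope.1 (hP 0)).mono_left
        (nhdsWithin_mono 0 (fun y (hy : 0 < y) => hy.ne'))
      rw [h0] at this
      refine this.congr fun y => ?_
      simp [slope, hm]
    have hlim : Filter.Tendsto (fun ε => ENNReal.ofReal ((m x - m ε) ^ 2))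
        (nhdsWithin 0 (Set.Ioi 0)) (nhds (ENNReal.ofReal (m x ^ 2))) := by
      apply ENNReal.tendsto_ofReal
      have := ((tendsto_const_nhds (x := m x)).sub hm0).pow 2
      simpa using this
    refine le_of_tendsto hlim ?_
    filter_upwards [Ioo_mem_nhdsGT hx0] with ε hε
    have hmd : ∀ y ∈ Set.uIcc ε x, HasDerivAt m (d y * y⁻¹) y := by
      intro y hy
      rw [Set.uIcc_of_le hε.2.le] at hy
      have hy0 : y ≠ 0 := by linarith [hy.1, hε.1]
      have := (hasDerivAt_inv hy0).mul (hP y)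
      refine HasDerivAt.congr_deriv this ?_
      simp only [hd, hm]
      field_simp
      ring
    have hmc : ContinuousOn m (Set.uIcc ε x) := fun y hy => (hmd y hy).continuousAt.continuousWithinAt
    have hdc : ContinuousOn (fun y => d y * y⁻¹) (Set.uIcc ε x) := by
      refine (hf.continuousOn.sub hmc).mul (continuousOn_id.inv₀ fun y hy => ?_)
      rw [Set.uIcc_of_le hε.2.le] at hy
      simp; linarith [hy.1, hε.1]
    have e1 := intervalIntegral.integral_eq_sub_of_hasDerivAt hmd hdc.intervalIntegrable
    have e2 : m x - m ε = ∫ y in Set.Ioo ε x, (d y * y ^ ((-1-b)/2)) * y ^ ((b-1)/2) := by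
      rw [← e1, intervalIntegral.integral_of_le hε.2.le, integral_Ioc_eq_integral_Ioo]
      refine setIntegral_congr_fun measurableSet_Ioo fun y hy => ?_
      have hy0 : 0 < y := by linarith [hy.1, hε.1]
      rw [mul_assoc, ← Real.rpow_add hy0, ← Real.rpow_neg_one]
      congr 2; ring
    rw [e2]
    refine (cs_real _ (by fun_prop) (by fun_prop)).trans ?_
    have hsub : Set.Ioo ε x ⊆ Set.Ioo 0 x := Set.Ioo_subset_Ioo_left hε.1.le
    rw [mul_comm]
    refine mul_le_mul' ?_ ?_
    · have e3 : ∫ y in (0:ℝ)..x, y ^ (b - 1) = x ^ b / b := by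
        rw [integral_rpow (Or.inl (by linarith))]
        simp [Real.zero_rpow hb0.ne']
      have e4 : IntegrableOn (fun y : ℝ => y ^ (b-1)) (Set.Ioo 0 x) := by
        have := (intervalIntegral.intervalIntegrable_rpow' (a := 0) (b := x) (r := b - 1) (by linarith))
        rw [intervalIntegrable_iff_integrableOn_Ioo_of_le hx0.le] at this
        exact this
      rw [← e3, intervalIntegral.integral_of_le hx0.le, integral_Ioc_eq_integral_Ioo,
        ofReal_integral_eq_lintegral_ofReal e4
          ((ae_restrict_iff' measurableSet_Ioo).2 (Filter.Eventually.of_forall fun y hy => Real.rpow_nonneg hy.1.le _))]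
      refine le_trans (lintegral_mono_set hsub) ?_
      refine setLIntegral_mono' measurableSet_Ioo fun y hy => ?_
      apply ENNReal.ofReal_le_ofReal
      rw [← Real.rpow_natCast, ← Real.rpow_mul hy.1.le]
      apply le_of_eq; congr 1; push_cast; ring
    · refine le_trans (lintegral_mono_set hsub) ?_
      refine setLIntegral_mono' measurableSet_Ioo fun y hy => ?_
      apply ENNReal.ofReal_le_ofReal
      rw [mul_pow, ← Real.rpow_natCast (y ^ _), ← Real.rpow_mul hy.1.le]
      apply le_of_eq; congr 2; push_cast; ring
  have B3 : ∫⁻ x in Set.Ioo (0:ℝ) 1, ENNReal.ofReal (m x ^ 2 * x ^ (-2 * γ)) ≤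
      ENNReal.ofReal (1 / b ^ 2) * ∫⁻ x in Set.Ioo (0:ℝ) 1, ENNReal.ofReal (d x ^ 2 * x ^ (-2 * γ)) := by
    calc ∫⁻ x in Set.Ioo (0:ℝ) 1, ENNReal.ofReal (m x ^ 2 * x ^ (-2 * γ))
        ≤ ∫⁻ x in Set.Ioo (0:ℝ) 1, ENNReal.ofReal (x ^ (b - 2 * γ) / b) *
            ∫⁻ y in Set.Ioo (0:ℝ) x, ENNReal.ofReal (d y ^ 2 * y ^ (-1-b)) := by
          refine setLIntegral_mono' measurableSet_Ioo fun x hx => ?_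
          rw [ENNReal.ofReal_mul (sq_nonneg _)]
          refine (mul_le_mul_left (B2 x hx) _).trans_eq ?_
          rw [mul_right_comm, ← ENNReal.ofReal_mul (by have := Real.rpow_nonneg hx.1.le b; positivity)]
          congr 2
          rw [sub_eq_add_neg, Real.rpow_add hx.1, neg_mul]; ring
      _ = ∫⁻ y in Set.Ioo (0:ℝ) 1, ENNReal.ofReal (d y ^ 2 * y ^ (-1-b)) *
            ∫⁻ x in Set.Ioo y 1, ENNReal.ofReal (x ^ (b - 2 * γ) / b) :=
          tri_swap (by fun_prop) (by fun_prop)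
      _ ≤ ∫⁻ y in Set.Ioo (0:ℝ) 1, ENNReal.ofReal (1 / b ^ 2) * ENNReal.ofReal (d y ^ 2 * y ^ (-2 * γ)) := by
          refine setLIntegral_mono' measurableSet_Ioo fun y hy => ?_
          have hy0 := hy.1
          have i1 : IntegrableOn (fun x : ℝ => x ^ (b - 2 * γ) / b) (Set.Ioi y) :=
            (integrableOn_Ioi_rpow_of_lt (by linarith) hy0).div_const _
          have i2 : ∫⁻ x in Set.Ioo y 1, ENNReal.ofReal (x ^ (b - 2 * γ) / b) ≤
              ENNReal.ofReal (y ^ (-b) / b ^ 2) := by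
            refine (lintegral_mono_set Set.Ioo_subset_Ioi_self).trans ?_
            rw [← ofReal_integral_eq_lintegral_ofReal i1
              ((ae_restrict_iff' measurableSet_Ioi).2 (Filter.Eventually.of_forall fun x hx => by
                have := Real.rpow_nonneg (hy0.trans hx).le (b - 2 * γ)
                positivity))]
            apply ENNReal.ofReal_le_ofReal
            rw [integral_div, integral_Ioi_rpow_of_lt (by linarith) hy0]
            have : b - 2 * γ + 1 = -b := by rw [hb]; ring
            rw [this]
            apply le_of_eq
            field_simp
          refine (mul_le_mul_right i2 _).trans_eq ?_
          rw [← ENNReal.ofReal_mul (by have := Real.rpow_nonneg hy0.le (-1-b); positivity),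
            ← ENNReal.ofReal_mul (by positivity)]
          congr 1
          have : y ^ (-2 * γ) = y ^ (-1 - b) * y ^ (-b) := by
            rw [← Real.rpow_add hy0]; congr 1; rw [hb]; ring
          rw [this]; ring
      _ = _ := by rw [lintegral_const_mul _ (by fun_prop)]
  set D := ∫⁻ x in Set.Ioo (0:ℝ) 1, ENNReal.ofReal (d x ^ 2 * x ^ (-2 * γ)) with hD
  calc ∫⁻ x in Set.Ioo (0:ℝ) 1, ENNReal.ofReal (f x ^ 2 * x ^ (-2 * γ))
      ≤ ∫⁻ x in Set.Ioo (0:ℝ) 1, (ENNReal.ofReal 2 * ENNReal.ofReal (d x ^ 2 * x ^ (-2 * γ))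
          + ENNReal.ofReal 2 * ENNReal.ofReal (m x ^ 2 * x ^ (-2 * γ))) := by
        refine setLIntegral_mono' measurableSet_Ioo fun x hx => ?_
        have := Real.rpow_nonneg hx.1.le (-2 * γ)
        rw [← ENNReal.ofReal_mul (by norm_num), ← ENNReal.ofReal_mul (by norm_num),
          ← ENNReal.ofReal_add (by positivity) (by positivity)]
        apply ENNReal.ofReal_le_ofReal
        have : f x ^ 2 ≤ 2 * d x ^ 2 + 2 * m x ^ 2 := by
          have : f x = d x + m x := by simp [hd]
          rw [this]; nlinarith [sq_nonneg (d x - m x)]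
        nlinarith
    _ = ENNReal.ofReal 2 * D + ENNReal.ofReal 2 * ∫⁻ x in Set.Ioo (0:ℝ) 1, ENNReal.ofReal (m x ^ 2 * x ^ (-2 * γ)) := by
        rw [lintegral_add_left (by fun_prop), lintegral_const_mul _ (by fun_prop),
          lintegral_const_mul _ (by fun_prop)]
    _ ≤ ENNReal.ofReal 2 * D + ENNReal.ofReal 2 * (ENNReal.ofReal (1 / b ^ 2) * D) := by gcongr
    _ = ENNReal.ofReal (2 + 2 / b ^ 2) * D := by
        rw [← mul_assoc, ← add_mul, ← ENNReal.ofReal_mul (by norm_num),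
          ← ENNReal.ofReal_add (by norm_num) (by positivity)]
        congr 3; ring
    _ ≤ _ := by
        gcongr
        exact setLIntegral_mono' measurableSet_Ioo B1

noncomputable def pf (v : ℝ → ℝ) (l t : ℝ) : ℝ :=
  v t - l * ∫ s in t..(1:ℝ), Real.exp (-l * (s - t)) * v s

lemma pf_cont {v : ℝ → ℝ} (hv : Continuous v) : Continuous (fun p : ℝ × ℝ => pf v p.1 p.2) := by
  have : Continuous (fun p : ℝ × ℝ => ∫ s in (1:ℝ)..p.2, Real.exp (-p.1 * (s - p.2)) * v s) := by
    apply intervalIntegral.continuous_parametric_intervalIntegral_of_continuous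
      (f := fun p : ℝ × ℝ => fun s => Real.exp (-p.1 * (s - p.2)) * v s)
    · simp only [Function.uncurry_def]; fun_prop
    · fun_prop
  unfold pf
  simp only [intervalIntegral.integral_symm 1]
  fun_prop

lemma pf_point {v : ℝ → ℝ} (hv : Continuous v) {l t : ℝ} (hl : 0 < l) (ht : t < 1) :
    pf v l t ^ 2 ≤ 2 * (∫ s in t..(1:ℝ), l * Real.exp (-l * (s - t)) * (v t - v s) ^ 2)
      + 2 * (Real.exp (-l * (1 - t)) * v t ^ 2) := by
  have hθ : ∫ s in t..(1:ℝ), l * Real.exp (-l * (s - t)) = 1 - Real.exp (-l * (1 - t)) := by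
    have : ∀ s ∈ Set.uIcc t 1, HasDerivAt (fun s => - Real.exp (-l * (s - t))) (l * Real.exp (-l * (s - t))) s := by
      intro s _
      have := ((((hasDerivAt_id s).sub_const t).const_mul (-l)).exp).neg
      refine HasDerivAt.congr_deriv this ?_
      simp; ring
    rw [intervalIntegral.integral_eq_sub_of_hasDerivAt this (Continuous.intervalIntegrable (by fun_prop) _ _)]
    simp; ring
  set E := Real.exp (-l * (1 - t)) with hE
  have hE0 : 0 < E := Real.exp_pos _
  have hE1 : E ≤ 1 := by
    rw [hE, Real.exp_le_one_iff]; nlinarith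
  set D := ∫ s in t..(1:ℝ), l * Real.exp (-l * (s - t)) * (v t - v s) with hD
  have hp : pf v l t = D + v t * E := by
    have : D = v t * (∫ s in t..(1:ℝ), l * Real.exp (-l * (s - t)))
        - l * ∫ s in t..(1:ℝ), Real.exp (-l * (s - t)) * v s := by
      rw [hD, ← intervalIntegral.integral_const_mul, ← intervalIntegral.integral_const_mul,
        ← intervalIntegral.integral_sub]
      · congr 1; ext s; ring
      all_goals exact Continuous.intervalIntegrable (by fun_prop) _ _
    rw [this, hθ, pf]; ring
  have hD2 : D ^ 2 ≤ ∫ s in t..(1:ℝ), l * Real.exp (-l * (s - t)) * (v t - v s) ^ 2 := by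
    have h0 : 0 ≤ ∫ s in t..(1:ℝ), l * Real.exp (-l * (s - t)) * (v t - v s - D) ^ 2 :=
      intervalIntegral.integral_nonneg ht.le fun s _ => by positivity
    have : ∫ s in t..(1:ℝ), l * Real.exp (-l * (s - t)) * (v t - v s - D) ^ 2 =
        (∫ s in t..(1:ℝ), l * Real.exp (-l * (s - t)) * (v t - v s) ^ 2)
        - 2 * D * (∫ s in t..(1:ℝ), l * Real.exp (-l * (s - t)) * (v t - v s))
        + D ^ 2 * ∫ s in t..(1:ℝ), l * Real.exp (-l * (s - t)) := by
      rw [← intervalIntegral.integral_const_mul (2 * D), ← intervalIntegral.integral_const_mul (D ^ 2),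
        ← intervalIntegral.integral_sub, ← intervalIntegral.integral_add]
      · congr 1; ext s; ring
      all_goals exact Continuous.intervalIntegrable (by fun_prop) _ _
    rw [this, ← hD, hθ] at h0
    nlinarith [sq_nonneg D]
  rw [hp]
  have : (v t * E) ^ 2 ≤ E * v t ^ 2 := by
    have : E * E ≤ E * 1 := by gcongr
    nlinarith [sq_nonneg (v t)]
  nlinarith [sq_nonneg (D - v t * E)]

lemma gamma_int {a r : ℝ} (ha : 0 < a) (hr : 0 < r) :
    IntegrableOn (fun l : ℝ => l ^ (a - 1) * Real.exp (-(r * l))) (Set.Ioi 0) := by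
  by_contra h
  have h1 := Real.integral_rpow_mul_exp_neg_mul_Ioi ha hr
  rw [integral_undef h] at h1
  have : 0 < (1 / r) ^ a * Real.Gamma a := mul_pos (Real.rpow_pos_of_pos (by positivity) _) (Real.Gamma_pos_of_pos ha)
  linarith

lemma gamma_lint {a r : ℝ} (ha : 0 < a) (hr : 0 < r) :
    ∫⁻ l in Set.Ioi (0:ℝ), ENNReal.ofReal (l ^ (a - 1) * Real.exp (-(r * l))) =
      ENNReal.ofReal ((1 / r) ^ a * Real.Gamma a) := by
  rw [← Real.integral_rpow_mul_exp_neg_mul_Ioi ha hr,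
    ofReal_integral_eq_lintegral_ofReal (gamma_int ha hr)]
  exact (ae_restrict_iff' measurableSet_Ioi).2 (Filter.Eventually.of_forall fun l hl => by
    have := Real.rpow_nonneg (le_of_lt hl) (a - 1)
    positivity)

lemma refl_lint (F : ℝ → ENNReal) :
    ∫⁻ x in Set.Ioo (0:ℝ) 1, F (1 - x) = ∫⁻ x in Set.Ioo (0:ℝ) 1, F x := by
  rw [← lintegral_indicator measurableSet_Ioo, ← lintegral_indicator measurableSet_Ioo,
    ← lintegral_sub_left_eq_self _ 1]
  refine lintegral_congr fun x => ?_
  have : 1 - x ∈ Set.Ioo (0:ℝ) 1 ↔ x ∈ Set.Ioo (0:ℝ) 1 := by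
    simp only [Set.mem_Ioo]; constructor <;> rintro ⟨h, h'⟩ <;> constructor <;> linarith
  simp only [Set.indicator_apply, this]
  simp

noncomputable def GagL (γ : ℝ) (v : ℝ → ℝ) : ENNReal :=
  ∫⁻ t in Set.Ioo (0:ℝ) 1, ∫⁻ s in Set.Ioo (0:ℝ) 1,
    ENNReal.ofReal ((v t - v s) ^ 2 / |t - s| ^ (1 + 2 * γ))

lemma hardy' {γ : ℝ} (h1 : 1 / 2 < γ) {v : ℝ → ℝ} (hv : Continuous v) (h0 : v 1 = 0) :
    ∫⁻ x in Set.Ioo (0:ℝ) 1, ENNReal.ofReal (v x ^ 2 * (1 - x) ^ (-2 * γ)) ≤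
      ENNReal.ofReal (2 + 2 / (γ - 1/2) ^ 2) * GagL γ v := by
  have h := hardy h1 (f := fun x => v (1 - x)) (by fun_prop) (by simpa using h0)
  rw [GagL, ← refl_lint (fun x => ENNReal.ofReal (v x ^ 2 * (1 - x) ^ (-2 * γ))),
    ← refl_lint (fun t => ∫⁻ s in Set.Ioo (0:ℝ) 1, ENNReal.ofReal ((v t - v s) ^ 2 / |t - s| ^ (1 + 2 * γ)))]
  simp only [sub_sub_cancel]
  refine h.trans_eq ?_
  congr 2; ext x
  rw [← refl_lint (fun s => ENNReal.ofReal ((v (1 - x) - v s) ^ 2 / |1 - x - s| ^ (1 + 2 * γ)))]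
  congr 1; ext y
  congr 3
  rw [← abs_neg]; ring_nf

lemma p_bound {γ : ℝ} (h1 : 1 / 2 < γ) {v : ℝ → ℝ} (hv : Continuous v) (h0 : v 1 = 0) :
    ∫⁻ l in Set.Ioi (0:ℝ), ∫⁻ t in Set.Ioo (0:ℝ) 1, ENNReal.ofReal (l ^ (2 * γ - 1) * pf v l t ^ 2) ≤
      ENNReal.ofReal (2 * Real.Gamma (2 * γ + 1) + 2 * Real.Gamma (2 * γ) * (2 + 2 / (γ - 1/2) ^ 2)) * GagL γ v := by
  have hpc := pf_cont hv
  have hG1 : 0 < Real.Gamma (2 * γ + 1) := Real.Gamma_pos_of_pos (by linarith)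
  have hG2 : 0 < Real.Gamma (2 * γ) := Real.Gamma_pos_of_pos (by linarith)
  rw [lintegral_lintegral_swap]
  swap
  · apply Measurable.aemeasurable
    simp only [Function.uncurry_def]
    have := hpc.measurable
    fun_prop
  have key : ∀ t ∈ Set.Ioo (0:ℝ) 1, ∫⁻ l in Set.Ioi (0:ℝ), ENNReal.ofReal (l ^ (2 * γ - 1) * pf v l t ^ 2) ≤
      ENNReal.ofReal (2 * Real.Gamma (2 * γ + 1)) * (∫⁻ s in Set.Ioo (0:ℝ) 1,
        ENNReal.ofReal ((v t - v s) ^ 2 / |t - s| ^ (1 + 2 * γ))) +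
      ENNReal.ofReal (2 * Real.Gamma (2 * γ)) * ENNReal.ofReal (v t ^ 2 * (1 - t) ^ (-2 * γ)) := by
    intro t ht
    have st1 : ∀ l ∈ Set.Ioi (0:ℝ), ENNReal.ofReal (l ^ (2 * γ - 1) * pf v l t ^ 2) ≤
        (∫⁻ s in Set.Ioo t 1, ENNReal.ofReal (2 * (v t - v s) ^ 2) *
          ENNReal.ofReal (l ^ ((2 * γ + 1) - 1) * Real.exp (-((s - t) * l)))) +
        ENNReal.ofReal (2 * v t ^ 2) * ENNReal.ofReal (l ^ (2 * γ - 1) * Real.exp (-((1 - t) * l))) := by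
      intro l hl
      have hl0 : 0 < l := hl
      have hlp : 0 < l ^ (2 * γ - 1) := Real.rpow_pos_of_pos hl0 _
      have hlp' : 0 < l ^ (2 * γ + 1 - 1) := Real.rpow_pos_of_pos hl0 _
      have hle : l ^ (2 * γ + 1 - 1) = l ^ (2 * γ - 1) * l := by
        rw [← Real.rpow_add_one hl0.ne']; congr 1; ring
      have hc : Continuous fun s => 2 * (v t - v s) ^ 2 * (l ^ (2 * γ + 1 - 1) * Real.exp (-((s - t) * l))) := by
        fun_prop
      have e1 : ∫⁻ s in Set.Ioo t 1, ENNReal.ofReal (2 * (v t - v s) ^ 2) *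
          ENNReal.ofReal (l ^ ((2 * γ + 1) - 1) * Real.exp (-((s - t) * l))) =
          ENNReal.ofReal (∫ s in t..(1:ℝ), 2 * (v t - v s) ^ 2 * (l ^ (2 * γ + 1 - 1) * Real.exp (-((s - t) * l)))) := by
        rw [intervalIntegral.integral_of_le ht.2.le, integral_Ioc_eq_integral_Ioo,
          ofReal_integral_eq_lintegral_ofReal
            ((hc.integrableOn_Icc (a := t) (b := 1)).mono_set Set.Ioo_subset_Icc_self)
            (Filter.Eventually.of_forall fun s => by positivity)]
        refine lintegral_congr fun s => ?_
        exact (ENNReal.ofReal_mul (by positivity)).symm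
      rw [e1, ← ENNReal.ofReal_mul (by positivity), ← ENNReal.ofReal_add
        (intervalIntegral.integral_nonneg ht.2.le fun s _ => by positivity) (by positivity)]
      apply ENNReal.ofReal_le_ofReal
      have h2 := mul_le_mul_of_nonneg_left (pf_point hv hl0 ht.2) hlp.le
      refine h2.trans_eq ?_
      rw [mul_add, ← intervalIntegral.integral_const_mul, ← intervalIntegral.integral_const_mul]
      congr 1
      · congr 1; ext s
        rw [hle, show -l * (s - t) = -((s - t) * l) by ring]; ring
      · rw [show -l * (1 - t) = -((1 - t) * l) by ring]; ring
    refine (setLIntegral_mono' measurableSet_Ioi st1).trans ?_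
    rw [lintegral_add_right _ (by fun_prop), lintegral_const_mul _ (by fun_prop),
      gamma_lint (by linarith) (by linarith [ht.2]), lintegral_lintegral_swap (by
        apply Measurable.aemeasurable
        simp only [Function.uncurry_def]
        fun_prop)]
    refine add_le_add ?_ ?_
    · rw [← lintegral_const_mul _ (by fun_prop)]
      refine le_trans ?_ (lintegral_mono_set (Set.Ioo_subset_Ioo_left ht.1.le))
      refine setLIntegral_mono' measurableSet_Ioo fun s hs => ?_
      have hst : 0 < s - t := by linarith [hs.1]
      rw [lintegral_const_mul _ (by fun_prop), gamma_lint (by linarith) hst,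
        ← ENNReal.ofReal_mul (by positivity), ← ENNReal.ofReal_mul (by positivity)]
      apply ENNReal.ofReal_le_ofReal
      rw [abs_sub_comm, abs_of_pos hst, one_div, Real.inv_rpow hst.le, add_comm 1 (2 * γ)]
      apply le_of_eq; ring
    · have : 0 < 1 - t := by linarith [ht.2]
      rw [← ENNReal.ofReal_mul (by positivity), ← ENNReal.ofReal_mul (by positivity)]
      apply ENNReal.ofReal_le_ofReal
      rw [one_div, Real.inv_rpow this.le, neg_mul, Real.rpow_neg this.le]
      apply le_of_eq; ring
  refine (setLIntegral_mono' measurableSet_Ioo key).trans ?_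
  rw [lintegral_add_right _ (by fun_prop), lintegral_const_mul _ (Measurable.lintegral_prod_right' (f := fun p : ℝ × ℝ =>
      ENNReal.ofReal ((v p.1 - v p.2) ^ 2 / |p.1 - p.2| ^ (1 + 2 * γ))) (by fun_prop)),
    lintegral_const_mul _ (by fun_prop)]
  have hh := hardy' h1 hv h0
  calc _ ≤ ENNReal.ofReal (2 * Real.Gamma (2 * γ + 1)) * GagL γ v
        + ENNReal.ofReal (2 * Real.Gamma (2 * γ)) * (ENNReal.ofReal (2 + 2 / (γ - 1/2) ^ 2) * GagL γ v) := by
        gcongr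
        exact le_rfl
    _ = _ := by
        rw [← mul_assoc, ← add_mul, ← ENNReal.ofReal_mul (by positivity),
          ← ENNReal.ofReal_add (by positivity) (by positivity)]

noncomputable abbrev mu01 : Measure ℝ := volume.restrict (Set.Ioo (0:ℝ) 1)

def triT : Set (ℝ × ℝ) := {p | p.1 < p.2}

lemma triT_meas : MeasurableSet triT := measurableSet_lt measurable_fst measurable_snd

lemma tri_prod1 {k : ℝ × ℝ → ℝ} (hk : Integrable (triT.indicator k) (mu01.prod mu01)) :
    ∫ p, triT.indicator k p ∂(mu01.prod mu01) = ∫ x in (0:ℝ)..1, ∫ y in x..(1:ℝ), k (x, y) := by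
  rw [integral_prod _ hk, intervalIntegral.integral_of_le zero_le_one, integral_Ioc_eq_integral_Ioo]
  refine setIntegral_congr_fun measurableSet_Ioo fun x hx => ?_
  rw [intervalIntegral.integral_of_le hx.2.le, integral_Ioc_eq_integral_Ioo]
  have : Set.Ioo x 1 = Set.Ioi x ∩ Set.Ioo 0 1 := by
    ext y; simp only [Set.mem_inter_iff, Set.mem_Ioi, Set.mem_Ioo]; constructor
    · rintro ⟨h, h'⟩; exact ⟨h, by linarith [hx.1], h'⟩
    · rintro ⟨h, _, h'⟩; exact ⟨h, h'⟩
  rw [this, ← Measure.restrict_restrict measurableSet_Ioi, ← integral_indicator measurableSet_Ioi]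
  rfl

lemma tri_prod2 {k : ℝ × ℝ → ℝ} (hk : Integrable (triT.indicator k) (mu01.prod mu01)) :
    ∫ p, triT.indicator k p ∂(mu01.prod mu01) = ∫ y in (0:ℝ)..1, ∫ x in (0:ℝ)..y, k (x, y) := by
  rw [integral_prod_symm _ hk, intervalIntegral.integral_of_le zero_le_one, integral_Ioc_eq_integral_Ioo]
  refine setIntegral_congr_fun measurableSet_Ioo fun y hy => ?_
  rw [intervalIntegral.integral_of_le hy.1.le, integral_Ioc_eq_integral_Ioo]
  have : Set.Ioo 0 y = Set.Iio y ∩ Set.Ioo 0 1 := by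
    ext x; simp only [Set.mem_inter_iff, Set.mem_Iio, Set.mem_Ioo]; constructor
    · rintro ⟨h, h'⟩; exact ⟨h', h, by linarith [hy.2]⟩
    · rintro ⟨h, h', _⟩; exact ⟨h', h⟩
  rw [this, ← Measure.restrict_restrict measurableSet_Iio, ← integral_indicator measurableSet_Iio]
  rfl

lemma tri_int_cont {k : ℝ × ℝ → ℝ} (hk : Continuous k) :
    Integrable (triT.indicator k) (mu01.prod mu01) := by
  refine Integrable.indicator ?_ triT_meas
  rw [Measure.prod_restrict]
  have : IntegrableOn k (Set.Icc 0 1 ×ˢ Set.Icc 0 1) :=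
    hk.continuousOn.integrableOn_compact (isCompact_Icc.prod isCompact_Icc)
  exact this.mono_set (Set.prod_mono Set.Ioo_subset_Icc_self Set.Ioo_subset_Icc_self)

noncomputable def rf (g : ℝ → ℝ) (l t : ℝ) : ℝ :=
  ∫ r in (0:ℝ)..t, ((t - r) ^ 2 / 2) * Real.exp (-l * (t - r)) * g r

lemma rf_deriv {g : ℝ → ℝ} (hg : Continuous g) (l t : ℝ) :
    HasDerivAt (rf g l) (qf g l t - l * rf g l t) t := by
  have hid : Continuous (fun r => r * g r) := by fun_prop
  have hid2 : Continuous (fun r => r ^ 2 * g r) := by fun_prop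
  have e : ∀ t, rf g l t = t ^ 2 / 2 * zf g l t - t * zf (fun r => r * g r) l t
      + 1 / 2 * zf (fun r => r ^ 2 * g r) l t := by
    intro t
    rw [rf, zf, zf, zf, ← intervalIntegral.integral_const_mul, ← intervalIntegral.integral_const_mul,
      ← intervalIntegral.integral_const_mul, ← intervalIntegral.integral_sub,
      ← intervalIntegral.integral_add]
    · congr 1; ext r; ring
    all_goals exact Continuous.intervalIntegrable (by fun_prop) _ _
  have eq : qf g l t = t * zf g l t - zf (fun r => r * g r) l t := by
    rw [qf, zf, zf, ← intervalIntegral.integral_const_mul, ← intervalIntegral.integral_sub]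
    · congr 1; ext r; ring
    · exact Continuous.intervalIntegrable (by fun_prop) _ _
    · exact Continuous.intervalIntegrable (by fun_prop) _ _
  have h := (((((hasDerivAt_id t).pow 2).div_const 2).mul (zf_deriv hg l t)).sub
    ((hasDerivAt_id t).mul (zf_deriv hid l t))).add ((zf_deriv hid2 l t).const_mul (1/2))
  have e' : rf g l = (fun t => t ^ 2 / 2 * zf g l t - t * zf (fun r => r * g r) l t
      + 1 / 2 * zf (fun r => r ^ 2 * g r) l t) := funext e
  rw [e t, e', eq]
  refine HasDerivAt.congr_deriv h ?_
  simp; ring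

lemma zf_qf {g : ℝ → ℝ} (hg : Continuous g) (l t : ℝ) : zf (qf g l) l t = rf g l t := by
  have hqc : Continuous (qf g l) := (qf_cont hg).comp (by fun_prop : Continuous fun t : ℝ => (l, t))
  have hd : ∀ t, HasDerivAt (fun t => Real.exp (l * t) * (zf (qf g l) l t - rf g l t)) 0 t := by
    intro t
    have h2 : HasDerivAt (fun t => Real.exp (l * t)) (Real.exp (l * t) * l) t := by
      have := ((hasDerivAt_id t).const_mul l).exp
      simpa using this
    have := h2.mul ((zf_deriv hqc l t).sub (rf_deriv hg l t))
    refine HasDerivAt.congr_deriv this ?_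
    simp only [Pi.sub_apply]
    ring
  have := is_const_of_deriv_eq_zero (fun t => (hd t).differentiableAt) (fun t => (hd t).deriv) t 0
  have h0 : zf (qf g l) l 0 - rf g l 0 = 0 := by simp [zf, rf]
  rw [h0, mul_zero] at this
  have := (mul_eq_zero.1 this).resolve_left (Real.exp_pos _).ne'
  linarith

noncomputable def kf (l h : ℝ) : ℝ := (h - l * h ^ 2 / 2) * Real.exp (-(h * l))

lemma pq_eq {v g : ℝ → ℝ} (hv : Continuous v) (hg : Continuous g) (l : ℝ) :
    ∫ t in (0:ℝ)..1, pf v l t * qf g l t =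
      ∫ p, triT.indicator (fun p => v p.2 * g p.1 * kf l (p.2 - p.1)) p ∂(mu01.prod mu01) := by
  have hqc : Continuous (qf g l) := (qf_cont hg).comp (by fun_prop : Continuous fun t : ℝ => (l, t))
  have hrc : Continuous (rf g l) := continuous_iff_continuousAt.2 fun t => (rf_deriv hg l t).continuousAt
  have hpc : Continuous (pf v l) := (pf_cont hv).comp (by fun_prop : Continuous fun t : ℝ => (l, t))
  have e1 : ∫ t in (0:ℝ)..1, (∫ s in t..(1:ℝ), Real.exp (-l * (s - t)) * v s * qf g l t) =
      ∫ s in (0:ℝ)..1, v s * rf g l s := by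
    have hi := tri_int_cont (k := fun p => Real.exp (-l * (p.2 - p.1)) * v p.2 * qf g l p.1) (by fun_prop)
    have h1 := tri_prod1 hi
    have h2 := tri_prod2 hi
    simp only at h1 h2
    rw [← h1, h2]
    congr 1; ext s
    rw [← zf_qf hg, zf, ← intervalIntegral.integral_const_mul]
    congr 1; ext t; ring
  have hU : Continuous fun t => ∫ s in t..(1:ℝ), Real.exp (-l * (s - t)) * v s * qf g l t := by
    simp only [intervalIntegral.integral_symm 1]
    refine Continuous.neg ?_
    apply intervalIntegral.continuous_parametric_intervalIntegral_of_continuous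
      (f := fun t : ℝ => fun s => Real.exp (-l * (s - t)) * v s * qf g l t)
    · simp only [Function.uncurry_def]; fun_prop
    · fun_prop
  have e2 : ∫ t in (0:ℝ)..1, pf v l t * qf g l t = (∫ t in (0:ℝ)..1, v t * qf g l t)
      - l * ∫ t in (0:ℝ)..1, (∫ s in t..(1:ℝ), Real.exp (-l * (s - t)) * v s * qf g l t) := by
    rw [← intervalIntegral.integral_const_mul, ← intervalIntegral.integral_sub]
    · congr 1; ext t; rw [pf, intervalIntegral.integral_mul_const]; ring
    all_goals exact Continuous.intervalIntegrable (by fun_prop) _ _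
  rw [e2, e1, tri_prod2 (tri_int_cont (by unfold kf; fun_prop)), ← intervalIntegral.integral_const_mul,
    ← intervalIntegral.integral_sub]
  · congr 1; ext s
    rw [qf, rf, ← intervalIntegral.integral_const_mul, ← intervalIntegral.integral_const_mul,
      ← intervalIntegral.integral_const_mul, ← intervalIntegral.integral_sub]
    · congr 1; ext r
      simp only [kf]
      rw [show -((s - r) * l) = -l * (s - r) by ring]; ring
    all_goals exact Continuous.intervalIntegrable (by fun_prop) _ _
  all_goals exact Continuous.intervalIntegrable (by fun_prop) _ _

lemma kf_int {γ h : ℝ} (h1 : 1 / 2 < γ) (hh : 0 < h) :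
    IntegrableOn (fun l => l ^ γ * kf l h) (Set.Ioi 0) ∧
    ∫ l in Set.Ioi (0:ℝ), l ^ γ * kf l h = Real.Gamma (γ + 1) * (1 - γ) / 2 * h ^ (-γ) ∧
    ∫ l in Set.Ioi (0:ℝ), ‖l ^ γ * kf l h‖ ≤ Real.Gamma (γ + 1) * (3 + γ) / 2 * h ^ (-γ) := by
  have i1 := (gamma_int (a := γ + 1) (r := h) (by linarith) hh).const_mul h
  have i2 := (gamma_int (a := γ + 2) (r := h) (by linarith) hh).const_mul (h ^ 2 / 2)
  have v1 : ∫ l in Set.Ioi (0:ℝ), h * (l ^ (γ + 1 - 1) * Real.exp (-(h * l))) = Real.Gamma (γ + 1) * h ^ (-γ) := by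
    rw [integral_const_mul, Real.integral_rpow_mul_exp_neg_mul_Ioi (by linarith) hh, one_div,
      Real.inv_rpow hh.le, Real.rpow_add_one hh.ne', Real.rpow_neg hh.le]
    have := (Real.rpow_pos_of_pos hh γ).ne'
    field_simp
  have v2 : ∫ l in Set.Ioi (0:ℝ), h ^ 2 / 2 * (l ^ (γ + 2 - 1) * Real.exp (-(h * l))) =
      Real.Gamma (γ + 1) * (γ + 1) / 2 * h ^ (-γ) := by
    rw [integral_const_mul, Real.integral_rpow_mul_exp_neg_mul_Ioi (by linarith) hh, one_div,
      Real.inv_rpow hh.le, show γ + 2 = (γ + 1) + 1 by ring, Real.Gamma_add_one (by linarith),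
      Real.rpow_add_one hh.ne', Real.rpow_add_one hh.ne', Real.rpow_neg hh.le]
    have := (Real.rpow_pos_of_pos hh γ).ne'
    field_simp
  have ee : ∀ l ∈ Set.Ioi (0:ℝ), l ^ γ * kf l h = h * (l ^ (γ + 1 - 1) * Real.exp (-(h * l)))
      - h ^ 2 / 2 * (l ^ (γ + 2 - 1) * Real.exp (-(h * l))) := by
    intro l hl
    rw [show γ + 2 - 1 = γ + 1 by ring, Real.rpow_add_one (ne_of_gt hl), show γ + 1 - 1 = γ by ring, kf]
    ring
  have en : ∀ l ∈ Set.Ioi (0:ℝ), ‖l ^ γ * kf l h‖ ≤ h * (l ^ (γ + 1 - 1) * Real.exp (-(h * l)))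
      + h ^ 2 / 2 * (l ^ (γ + 2 - 1) * Real.exp (-(h * l))) := by
    intro l hl
    rw [ee l hl]
    have a1 := Real.rpow_nonneg (le_of_lt hl) (γ + 1 - 1)
    have a2 := Real.rpow_nonneg (le_of_lt hl) (γ + 2 - 1)
    have b1 : 0 ≤ h * (l ^ (γ + 1 - 1) * Real.exp (-(h * l))) := by positivity
    have b2 : 0 ≤ h ^ 2 / 2 * (l ^ (γ + 2 - 1) * Real.exp (-(h * l))) := by positivity
    rw [Real.norm_eq_abs, abs_le]; constructor <;> linarith
  have I : IntegrableOn (fun l => l ^ γ * kf l h) (Set.Ioi 0) :=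
    IntegrableOn.congr_fun (i1.sub i2) (fun l hl => (ee l hl).symm) measurableSet_Ioi
  refine ⟨I, ?_, ?_⟩
  · rw [setIntegral_congr_fun measurableSet_Ioi ee, integral_sub i1 i2, v1, v2]; ring
  · refine (setIntegral_mono_on I.norm (i1.add i2) measurableSet_Ioi en).trans_eq ?_
    simp only [Pi.add_apply]
    rw [integral_add i1 i2, v1, v2]; ring

lemma ker_int {γ : ℝ} (h2 : γ < 1) :
    Integrable (triT.indicator (fun p => (p.2 - p.1) ^ (-γ))) (mu01.prod mu01) := by
  have hm : Measurable (triT.indicator (fun p : ℝ × ℝ => (p.2 - p.1) ^ (-γ))) :=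
    Measurable.indicator (by fun_prop) triT_meas
  refine ⟨hm.aestronglyMeasurable, ?_⟩
  rw [HasFiniteIntegral, lintegral_prod _ hm.enorm.aemeasurable]
  have hb : IntegrableOn (fun x : ℝ => x ^ (-γ)) (Set.Ioo 0 1) := by
    have := (intervalIntegral.intervalIntegrable_rpow' (a := 0) (b := 1) (r := -γ) (by linarith))
    rwa [intervalIntegrable_iff_integrableOn_Ioo_of_le zero_le_one] at this
  have hfin : ∫⁻ x in Set.Ioo (0:ℝ) 1, ‖x ^ (-γ)‖ₑ < ⊤ := hb.2
  have : ∀ x ∈ Set.Ioo (0:ℝ) 1, ∫⁻ y in Set.Ioo (0:ℝ) 1, ‖triT.indicator (fun p : ℝ × ℝ => (p.2 - p.1) ^ (-γ)) (x, y)‖ₑ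
      ≤ ∫⁻ x in Set.Ioo (0:ℝ) 1, ‖x ^ (-γ)‖ₑ := by
    intro x hx
    rw [← lintegral_indicator measurableSet_Ioo, ← lintegral_indicator measurableSet_Ioo,
      ← lintegral_sub_right_eq_self (Set.indicator (Set.Ioo (0:ℝ) 1) fun x => ‖x ^ (-γ)‖ₑ) x]
    refine lintegral_mono fun y => ?_
    by_cases hy : y ∈ Set.Ioo (0:ℝ) 1
    · by_cases hxy : x < y
      · have : y - x ∈ Set.Ioo (0:ℝ) 1 := ⟨by linarith, by linarith [hy.2, hx.1]⟩
        simp [Set.indicator_of_mem hy, Set.indicator_of_mem this, triT, hxy]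
      · simp [Set.indicator_of_mem hy, triT, hxy]
    · simp [Set.indicator_of_notMem hy]
  refine (setLIntegral_mono' measurableSet_Ioo this).trans_lt ?_
  simp [hfin]

lemma F_int {γ : ℝ} (h2 : γ < 1) {v g : ℝ → ℝ} (hv : Continuous v) (hg : Continuous g) :
    Integrable (triT.indicator (fun p => v p.2 * g p.1 * (p.2 - p.1) ^ (-γ))) (mu01.prod mu01) := by
  have e : triT.indicator (fun p : ℝ × ℝ => v p.2 * g p.1 * (p.2 - p.1) ^ (-γ)) =
      fun p => (v p.2 * g p.1) * triT.indicator (fun p => (p.2 - p.1) ^ (-γ)) p := by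
    ext p; by_cases hp : p ∈ triT <;> simp [hp]
  rw [e]
  have hc : Continuous fun p : ℝ × ℝ => v p.2 * g p.1 := by fun_prop
  obtain ⟨M, hM⟩ := (isCompact_Icc.prod isCompact_Icc : IsCompact (Set.Icc (0:ℝ) 1 ×ˢ Set.Icc (0:ℝ) 1)).exists_bound_of_continuousOn hc.continuousOn
  refine (ker_int h2).bdd_mul (c := M) hc.aestronglyMeasurable ?_
  rw [Measure.prod_restrict]
  refine (ae_restrict_iff' (measurableSet_Ioo.prod measurableSet_Ioo)).2 (Filter.Eventually.of_forall fun p hp => ?_)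
  exact hM p (Set.prod_mono Set.Ioo_subset_Icc_self Set.Ioo_subset_Icc_self hp)

lemma main_id {γ : ℝ} (h1 : 1 / 2 < γ) (h2 : γ < 1) {v g : ℝ → ℝ} (hv : Continuous v) (hg : Continuous g) :
    IntegrableOn (fun l => l ^ γ * ∫ t in (0:ℝ)..1, pf v l t * qf g l t) (Set.Ioi 0) ∧
    ∫ l in Set.Ioi (0:ℝ), l ^ γ * ∫ t in (0:ℝ)..1, pf v l t * qf g l t =
      Real.Gamma (γ + 1) * (1 - γ) / 2 *
        ∫ r in (0:ℝ)..1, g r * ∫ s in r..(1:ℝ), (s - r) ^ (-γ) * v s := by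
  set Φ : ℝ → ℝ × ℝ → ℝ := fun l p => l ^ γ * triT.indicator (fun p => v p.2 * g p.1 * kf l (p.2 - p.1)) p with hΦ
  have e0 : ∀ l, l ^ γ * ∫ t in (0:ℝ)..1, pf v l t * qf g l t = ∫ p, Φ l p ∂(mu01.prod mu01) := by
    intro l
    rw [pq_eq hv hg, integral_const_mul]
  have eΦ : ∀ l p, Φ l p = triT.indicator (fun p => v p.2 * g p.1 * (l ^ γ * kf l (p.2 - p.1))) p := by
    intro l p
    simp only [hΦ]
    by_cases hp : p ∈ triT
    · simp only [Set.indicator_of_mem hp]; ring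
    · simp only [Set.indicator_of_notMem hp]; ring
  have hmeas : Measurable (Function.uncurry Φ) := by
    have : Function.uncurry Φ = Set.indicator (Prod.snd ⁻¹' triT)
        (fun q : ℝ × (ℝ × ℝ) => v q.2.2 * g q.2.1 * (q.1 ^ γ * kf q.1 (q.2.2 - q.2.1))) := by
      ext ⟨l, p⟩
      simp only [Function.uncurry_apply_pair, eΦ]
      rfl
    rw [this]
    refine Measurable.indicator ?_ (measurable_snd triT_meas)
    unfold kf; fun_prop
  have hInt : Integrable (Function.uncurry Φ) ((volume.restrict (Set.Ioi (0:ℝ))).prod (mu01.prod mu01)) := by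
    rw [integrable_prod_iff' hmeas.aestronglyMeasurable]
    constructor
    · refine Filter.Eventually.of_forall fun p => ?_
      simp only [Function.uncurry_apply_pair, eΦ]
      by_cases hp : p ∈ triT
      · simp only [Set.indicator_of_mem hp]
        exact (kf_int h1 (sub_pos.2 hp)).1.const_mul _
      · simp only [Set.indicator_of_notMem hp]; exact integrable_zero _ _ _
    · refine Integrable.mono' (((F_int h2 hv hg).norm).const_mul (Real.Gamma (γ + 1) * (3 + γ) / 2)) ?_ ?_
      · exact hmeas.norm.aestronglyMeasurable.prod_swap.integral_prod_right'
      · refine Filter.Eventually.of_forall fun p => ?_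
        simp only [Function.uncurry_apply_pair, eΦ]
        by_cases hp : p ∈ triT
        · simp only [Set.indicator_of_mem hp]
          have := (kf_int h1 (sub_pos.2 hp)).2.2
          simp only [norm_mul (v p.2 * g p.1), integral_const_mul]
          have hpos : 0 ≤ (p.2 - p.1) ^ (-γ) := Real.rpow_nonneg (sub_pos.2 hp).le _
          rw [norm_mul, norm_norm, Real.norm_of_nonneg (integral_nonneg fun _ => norm_nonneg _),
            Real.norm_of_nonneg hpos]
          calc _ ≤ ‖v p.2 * g p.1‖ * _ := mul_le_mul_of_nonneg_left this (norm_nonneg _)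
            _ = _ := by ring
        · simp [Set.indicator_of_notMem hp]
  constructor
  · simp only [e0]
    exact hInt.integral_prod_left
  · simp only [e0]
    rw [integral_integral_swap hInt]
    have e3 : ∀ p, ∫ l in Set.Ioi (0:ℝ), Φ l p = Real.Gamma (γ + 1) * (1 - γ) / 2 *
        triT.indicator (fun p => v p.2 * g p.1 * (p.2 - p.1) ^ (-γ)) p := by
      intro p
      simp only [eΦ]
      by_cases hp : p ∈ triT
      · simp only [Set.indicator_of_mem hp]
        rw [integral_const_mul, (kf_int h1 (sub_pos.2 hp)).2.1]; ring
      · simp only [Set.indicator_of_notMem hp]; simp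
    simp only [e3]
    rw [integral_const_mul, tri_prod1 (F_int h2 hv hg)]
    congr 2; ext r
    rw [← intervalIntegral.integral_const_mul]
    congr 1; ext s; ring


lemma riesz_ext {V E : Type*} [AddCommGroup V] [Module ℝ V] [NormedAddCommGroup E]
    [InnerProductSpace ℝ E] [CompleteSpace E] (T : V →ₗ[ℝ] E) (ℓ : V →ₗ[ℝ] ℝ) {K : ℝ} (hK : 0 ≤ K)
    (h : ∀ x, |ℓ x| ≤ K * ‖T x‖) : ∃ w : E, ‖w‖ ≤ K ∧ ∀ x, ℓ x = inner ℝ w (T x) := by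
  obtain ⟨s, hs⟩ := T.rangeRestrict.exists_rightInverse_of_surjective (LinearMap.range_rangeRestrict T)
  have hs' : ∀ y : LinearMap.range T, T (s y) = y := by
    intro y
    have := LinearMap.congr_fun hs y
    simpa using congrArg Subtype.val this
  let f : StrongDual ℝ (LinearMap.range T) := (ℓ ∘ₗ s).mkContinuous K (by
    intro y
    have := h (s y)
    rw [hs' y] at this
    simpa using this)
  have hfn : ‖f‖ ≤ K := LinearMap.mkContinuous_norm_le _ hK _
  obtain ⟨F, hF, hFn⟩ := exists_extension_norm_eq (LinearMap.range T) f
  refine ⟨(InnerProductSpace.toDual ℝ E).symm F, ?_, ?_⟩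
  · rw [LinearIsometryEquiv.norm_map, hFn]; exact hfn
  · intro x
    rw [InnerProductSpace.toDual_symm_apply]
    have := hF ⟨T x, LinearMap.mem_range_self T x⟩
    simp only at this
    rw [this]
    change ℓ x = ℓ (s ⟨T x, _⟩)
    have h3 := h (s ⟨T x, LinearMap.mem_range_self T x⟩ - x)
    rw [map_sub T, hs'] at h3
    simp only [sub_self, norm_zero, mul_zero] at h3
    have := abs_nonpos_iff.1 h3
    rw [map_sub] at this
    linarith

lemma tri_int_left {k : ℝ × ℝ → ℝ} (hk : Integrable (triT.indicator k) (mu01.prod mu01)) :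
    IntegrableOn (fun x => ∫ y in x..(1:ℝ), k (x, y)) (Set.Ioo 0 1) := by
  refine IntegrableOn.congr_fun hk.integral_prod_left (fun x hx => ?_) measurableSet_Ioo
  rw [intervalIntegral.integral_of_le hx.2.le, integral_Ioc_eq_integral_Ioo]
  have : Set.Ioo x 1 = Set.Ioi x ∩ Set.Ioo 0 1 := by
    ext y; simp only [Set.mem_inter_iff, Set.mem_Ioi, Set.mem_Ioo]; constructor
    · rintro ⟨h, h'⟩; exact ⟨h, by linarith [hx.1], h'⟩
    · rintro ⟨h, _, h'⟩; exact ⟨h, h'⟩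
  rw [this, ← Measure.restrict_restrict measurableSet_Ioi, ← integral_indicator measurableSet_Ioi]
  rfl

noncomputable def cOne (γ : ℝ) : ℝ :=
  2 * Real.Gamma (2 * γ + 1) + 2 * Real.Gamma (2 * γ) * (2 + 2 / (γ - 1/2) ^ 2)

lemma cOne_pos {γ : ℝ} (h1 : 1 / 2 < γ) : 0 < cOne γ := by
  have hG1 : 0 < Real.Gamma (2 * γ + 1) := Real.Gamma_pos_of_pos (by linarith)
  have hG2 : 0 < Real.Gamma (2 * γ) := Real.Gamma_pos_of_pos (by linarith)
  unfold cOne; positivity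

lemma ell_trunc {γ : ℝ} (h1 : 1 / 2 < γ) {v g : ℝ → ℝ} (hv : Continuous v)
    (hg : Continuous g) (h0 : v 1 = 0) {N : ℝ} (hN : GagL γ v ≤ ENNReal.ofReal (N ^ 2))
    {L : ℝ} (hL : 0 < L) :
    (∫ l in (0:ℝ)..L, l ^ γ * ∫ t in (0:ℝ)..1, pf v l t * qf g l t) ^ 2 ≤
      cOne γ * N ^ 2 * ((1 / 2) * ∫ t in (0:ℝ)..1, (∫ r in (0:ℝ)..t, g r) ^ 2) := by
  have hpc := pf_cont hv
  have hqc := qf_cont hg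
  have hC := cOne_pos h1
  set ν : Measure ℝ := volume.restrict (Set.Ioo (0:ℝ) L) with hν
  have hci : ∀ k : ℝ × ℝ → ℝ, Continuous k → Integrable k (ν.prod mu01) := by
    intro k hk
    rw [Measure.prod_restrict]
    have : IntegrableOn k (Set.Icc 0 L ×ˢ Set.Icc 0 1) :=
      hk.continuousOn.integrableOn_compact (isCompact_Icc.prod isCompact_Icc)
    exact this.mono_set (Set.prod_mono Set.Ioo_subset_Icc_self Set.Ioo_subset_Icc_self)
  have cγ : Continuous fun l : ℝ => l ^ γ := Real.continuous_rpow_const (by linarith)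
  have e1 : ∫ l in (0:ℝ)..L, l ^ γ * ∫ t in (0:ℝ)..1, pf v l t * qf g l t =
      ∫ q, (q.1 ^ (γ - 1/2) * pf v q.1 q.2) * (q.1 ^ (1/2:ℝ) * qf g q.1 q.2) ∂(ν.prod mu01) := by
    have : ∫ q, (q.1 ^ (γ - 1/2) * pf v q.1 q.2) * (q.1 ^ (1/2:ℝ) * qf g q.1 q.2) ∂(ν.prod mu01)
        = ∫ q, q.1 ^ γ * (pf v q.1 q.2 * qf g q.1 q.2) ∂(ν.prod mu01) := by
      rw [Measure.prod_restrict]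
      refine setIntegral_congr_fun (measurableSet_Ioo.prod measurableSet_Ioo) fun q hq => ?_
      have hq0 : 0 < q.1 := hq.1.1
      have : q.1 ^ γ = q.1 ^ (γ - 1/2) * q.1 ^ (1/2:ℝ) := by
        rw [← Real.rpow_add hq0]; congr 1; ring
      try simp only
      rw [this]; ring
    rw [this, integral_prod _ (hci _ (by fun_prop)), intervalIntegral.integral_of_le hL.le,
      integral_Ioc_eq_integral_Ioo]
    congr 1; ext l
    rw [intervalIntegral.integral_of_le zero_le_one, integral_Ioc_eq_integral_Ioo]
    exact (integral_const_mul _ _).symm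
  have m1 : Measurable fun q : ℝ × ℝ => q.1 ^ (γ - 1/2) * pf v q.1 q.2 := by
    have := hpc.measurable; fun_prop
  have m2 : Measurable fun q : ℝ × ℝ => q.1 ^ (1/2:ℝ) * qf g q.1 q.2 := by
    have := hqc.measurable; fun_prop
  have hcs := cs_real (ν.prod mu01) m1.aemeasurable m2.aemeasurable
  rw [← e1] at hcs
  have b1 : ∫⁻ q, ENNReal.ofReal ((q.1 ^ (γ - 1/2) * pf v q.1 q.2) ^ 2) ∂(ν.prod mu01) ≤
      ENNReal.ofReal (cOne γ * N ^ 2) := by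
    rw [lintegral_prod _ (by fun_prop)]
    calc _ ≤ ∫⁻ l in Set.Ioi (0:ℝ), ∫⁻ t in Set.Ioo (0:ℝ) 1, ENNReal.ofReal (l ^ (2 * γ - 1) * pf v l t ^ 2) := by
          refine le_trans ?_ (lintegral_mono_set (fun x hx => hx.1 : Set.Ioo (0:ℝ) L ⊆ Set.Ioi 0))
          refine setLIntegral_mono' measurableSet_Ioo fun l hl => ?_
          refine lintegral_mono fun t => ENNReal.ofReal_le_ofReal (le_of_eq ?_)
          rw [mul_pow, ← Real.rpow_natCast (l ^ _), ← Real.rpow_mul hl.1.le]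
          congr 2; push_cast; ring
      _ ≤ _ := p_bound h1 hv h0
      _ ≤ ENNReal.ofReal (cOne γ) * ENNReal.ofReal (N ^ 2) := mul_le_mul_right hN _
      _ = _ := by rw [ENNReal.ofReal_mul hC.le]
  have b2 : ∫⁻ q, ENNReal.ofReal ((q.1 ^ (1/2:ℝ) * qf g q.1 q.2) ^ 2) ∂(ν.prod mu01) ≤
      ENNReal.ofReal ((1 / 2) * ∫ t in (0:ℝ)..1, (∫ r in (0:ℝ)..t, g r) ^ 2) := by
    have hk : Continuous fun q : ℝ × ℝ => q.1 * qf g q.1 q.2 ^ 2 := by fun_prop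
    have : ∫⁻ q, ENNReal.ofReal ((q.1 ^ (1/2:ℝ) * qf g q.1 q.2) ^ 2) ∂(ν.prod mu01) =
        ∫⁻ q, ENNReal.ofReal (q.1 * qf g q.1 q.2 ^ 2) ∂(ν.prod mu01) := by
      rw [Measure.prod_restrict]
      refine setLIntegral_congr_fun (measurableSet_Ioo.prod measurableSet_Ioo) fun q hq => ?_
      have hq0 : 0 < q.1 := hq.1.1
      rw [mul_pow, ← Real.sqrt_eq_rpow, Real.sq_sqrt hq0.le]
    rw [this, ← ofReal_integral_eq_lintegral_ofReal (hci _ hk)]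
    · apply ENNReal.ofReal_le_ofReal
      rw [integral_prod _ (hci _ hk)]
      have := square_fn hg hL
      rw [intervalIntegral.integral_of_le hL.le, integral_Ioc_eq_integral_Ioo] at this
      refine le_trans (le_of_eq ?_) this
      congr 1; ext l
      rw [intervalIntegral.integral_of_le zero_le_one, integral_Ioc_eq_integral_Ioo]
    · rw [Measure.prod_restrict]
      refine (ae_restrict_iff' (measurableSet_Ioo.prod measurableSet_Ioo)).2 (Filter.Eventually.of_forall fun q hq => ?_)
      have hq0 : 0 < q.1 := hq.1.1
      simp only [Pi.zero_apply]
      positivity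
  have h3 := hcs.trans (mul_le_mul' b1 b2)
  have hnn : 0 ≤ ∫ t in (0:ℝ)..1, (∫ r in (0:ℝ)..t, g r) ^ 2 :=
    intervalIntegral.integral_nonneg zero_le_one fun _ _ => sq_nonneg _
  rw [← ENNReal.ofReal_mul (by positivity)] at h3
  exact (ENNReal.ofReal_le_ofReal_iff (by positivity)).1 h3

noncomputable def cTwo (γ : ℝ) : ℝ :=
  (Real.Gamma (γ + 1) * (1 - γ) / 2)⁻¹ * Real.sqrt (cOne γ / 2)

lemma cTwo_pos {γ : ℝ} (h1 : 1 / 2 < γ) (h2 : γ < 1) : 0 < cTwo γ := by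
  have hG1 : 0 < Real.Gamma (γ + 1) := Real.Gamma_pos_of_pos (by linarith)
  have := cOne_pos h1
  have : 0 < 1 - γ := by linarith
  unfold cTwo; positivity

lemma ell_bound {γ : ℝ} (h1 : 1 / 2 < γ) (h2 : γ < 1) {v g : ℝ → ℝ} (hv : Continuous v)
    (hg : Continuous g) (h0 : v 1 = 0) {N : ℝ} (hN0 : 0 ≤ N) (hN : GagL γ v ≤ ENNReal.ofReal (N ^ 2)) :
    |∫ r in (0:ℝ)..1, g r * ∫ s in r..(1:ℝ), (s - r) ^ (-γ) * v s| ≤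
      cTwo γ * N * Real.sqrt (∫ t in (0:ℝ)..1, (∫ r in (0:ℝ)..t, g r) ^ 2) := by
  obtain ⟨hI, hE⟩ := main_id h1 h2 hv hg
  have hlim := intervalIntegral_tendsto_integral_Ioi 0 hI Filter.tendsto_id
  have hle := le_of_tendsto (hlim.pow 2) (by
    filter_upwards [Filter.eventually_gt_atTop 0] with L hL
    exact ell_trunc h1 hv hg h0 hN hL)
  rw [hE] at hle
  have hG1 : 0 < Real.Gamma (γ + 1) := Real.Gamma_pos_of_pos (by linarith)
  have hc : 0 < Real.Gamma (γ + 1) * (1 - γ) / 2 := by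
    have : 0 < 1 - γ := by linarith
    positivity
  have hC := cOne_pos h1
  have hnn : 0 ≤ ∫ t in (0:ℝ)..1, (∫ r in (0:ℝ)..t, g r) ^ 2 :=
    intervalIntegral.integral_nonneg zero_le_one fun _ _ => sq_nonneg _
  unfold cTwo
  set c := Real.Gamma (γ + 1) * (1 - γ) / 2
  set I := ∫ r in (0:ℝ)..1, g r * ∫ s in r..(1:ℝ), (s - r) ^ (-γ) * v s
  set Q := ∫ t in (0:ℝ)..1, (∫ r in (0:ℝ)..t, g r) ^ 2
  refine abs_le_of_sq_le_sq ?_ (by positivity)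
  have : (c⁻¹ * Real.sqrt (cOne γ / 2) * N * Real.sqrt Q) ^ 2 = c⁻¹ ^ 2 * (cOne γ * N ^ 2 * (1 / 2 * Q)) := by
    rw [mul_pow, mul_pow, mul_pow, Real.sq_sqrt hnn, Real.sq_sqrt (by positivity)]; ring
  rw [this]
  calc I ^ 2 = c⁻¹ ^ 2 * (c * I) ^ 2 := by field_simp
    _ ≤ _ := by gcongr

lemma norm_L2 (f : Lp ℝ 2 mu01) : Real.sqrt (∫ s, f s ^ 2 ∂mu01) = ‖f‖ := by
  rw [← Real.sqrt_sq (norm_nonneg f), ← real_inner_self_eq_norm_sq, L2.inner_def]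
  congr 1
  refine integral_congr_ae (Filter.Eventually.of_forall fun s => ?_)
  simp [sq]

lemma core {γ : ℝ} (h1 : 1 / 2 < γ) (h2 : γ < 1) {v : ℝ → ℝ} (hv : Continuous v)
    (h0 : v 1 = 0) {N : ℝ} (hN0 : 0 ≤ N) (hN : GagL γ v ≤ ENNReal.ofReal (N ^ 2)) :
    ∃ w : ℝ → ℝ, Measurable w ∧ IntegrableOn (fun s => (w s) ^ 2) (Set.Ioo 0 1) ∧
      Real.sqrt (∫ s in Set.Ioo (0 : ℝ) 1, (w s) ^ 2) ≤ cTwo γ * N ∧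
      ∀ᵐ t ∂(volume.restrict (Set.Ioo (0 : ℝ) 1)),
        ∫ s in t..(1:ℝ), (s - t) ^ (-γ) * v s = ∫ s in t..(1 : ℝ), w s := by
  have hφc : ∀ g : C(ℝ, ℝ), Continuous (fun t => ∫ r in (0:ℝ)..t, g r) := fun g =>
    intervalIntegral.continuous_primitive (fun a b => g.continuous.intervalIntegrable a b) 0
  have hmem : ∀ f : ℝ → ℝ, Continuous f → MemLp f 2 mu01 := by
    intro f hf
    rw [memLp_two_iff_integrable_sq hf.aestronglyMeasurable]
    exact ((hf.pow 2).integrableOn_Icc (a := 0) (b := 1)).mono_set Set.Ioo_subset_Icc_self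
  have hFint : IntegrableOn (fun r => ∫ s in r..(1:ℝ), (s - r) ^ (-γ) * v s) (Set.Ioo 0 1) := by
    have := tri_int_left (F_int h2 hv (continuous_const (y := (1:ℝ))))
    refine this.congr_fun (fun r _ => ?_) measurableSet_Ioo
    simp only
    congr 1; ext s; ring
  set F : ℝ → ℝ := fun r => ∫ s in r..(1:ℝ), (s - r) ^ (-γ) * v s with hF
  have hgF : ∀ g : C(ℝ, ℝ), IntervalIntegrable (fun r => g r * F r) volume 0 1 := by
    intro g
    have : IntervalIntegrable F volume 0 1 := by
      rw [intervalIntegrable_iff_integrableOn_Ioo_of_le zero_le_one]; exact hFint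
    exact this.continuousOn_mul g.continuous.continuousOn
  let T : C(ℝ, ℝ) →ₗ[ℝ] Lp ℝ 2 mu01 :=
    { toFun := fun g => (hmem _ (hφc g)).toLp _
      map_add' := by
        intro g g'
        rw [← MemLp.toLp_add]
        apply MemLp.toLp_congr
        refine Filter.Eventually.of_forall fun t => ?_
        simp only [Pi.add_apply, ContinuousMap.add_apply]
        exact intervalIntegral.integral_add (g.continuous.intervalIntegrable _ _) (g'.continuous.intervalIntegrable _ _)
      map_smul' := by
        intro a g
        simp only [RingHom.id_apply]
        rw [← MemLp.toLp_const_smul]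
        apply MemLp.toLp_congr
        refine Filter.Eventually.of_forall fun t => ?_
        simp }
  let ℓ : C(ℝ, ℝ) →ₗ[ℝ] ℝ :=
    { toFun := fun g => ∫ r in (0:ℝ)..1, g r * F r
      map_add' := by
        intro g g'
        rw [← intervalIntegral.integral_add (hgF g) (hgF g')]
        congr 1; ext r; simp [add_mul]
      map_smul' := by
        intro a g
        simp only [RingHom.id_apply, smul_eq_mul]
        rw [← intervalIntegral.integral_const_mul]
        congr 1; ext r; simp [mul_assoc] }
  have hTn : ∀ g, ‖T g‖ = Real.sqrt (∫ t in (0:ℝ)..1, (∫ r in (0:ℝ)..t, g r) ^ 2) := by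
    intro g
    rw [← norm_L2, intervalIntegral.integral_of_le zero_le_one, integral_Ioc_eq_integral_Ioo]
    congr 1
    refine integral_congr_ae ?_
    filter_upwards [(hmem _ (hφc g)).coeFn_toLp] with s hs
    change (((hmem _ (hφc g)).toLp _ : Lp ℝ 2 mu01) s) ^ 2 = _
    rw [hs]
  have hb : ∀ g, |ℓ g| ≤ cTwo γ * N * ‖T g‖ := by
    intro g
    rw [hTn]
    exact ell_bound h1 h2 hv g.continuous h0 hN0 hN
  obtain ⟨w, hwn, hw⟩ := riesz_ext T ℓ (mul_nonneg (cTwo_pos h1 h2).le hN0) hb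
  have hwm : MemLp w 2 mu01 := Lp.memLp w
  have hwi : Integrable w mu01 := hwm.integrable (by norm_num)
  have hws : Integrable (fun s => w s ^ 2) mu01 := hwm.integrable_sq
  refine ⟨w, (Lp.stronglyMeasurable w).measurable, hws, ?_, ?_⟩
  · refine le_trans (le_of_eq ?_) hwn
    exact norm_L2 w
  · have hkint : ∀ g : C(ℝ, ℝ), Integrable (triT.indicator fun p : ℝ × ℝ => g p.1 * w p.2) (mu01.prod mu01) := by
      intro g
      refine Integrable.indicator ?_ triT_meas
      exact Integrable.mul_prod ((hmem g g.continuous).integrable (by norm_num)) hwi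
    have hWint : IntegrableOn (fun r => ∫ s in r..(1:ℝ), w s) (Set.Ioo 0 1) := by
      have := tri_int_left (hkint 1)
      simpa using this
    have hgW : ∀ g : C(ℝ, ℝ), IntervalIntegrable (fun r => g r * ∫ s in r..(1:ℝ), w s) volume 0 1 := by
      intro g
      have : IntervalIntegrable (fun r => ∫ s in r..(1:ℝ), w s) volume 0 1 := by
        rw [intervalIntegrable_iff_integrableOn_Ioo_of_le zero_le_one]; exact hWint
      exact this.continuousOn_mul g.continuous.continuousOn
    have heq : ∀ g : C(ℝ, ℝ), ∫ r in (0:ℝ)..1, g r * F r = ∫ r in (0:ℝ)..1, g r * ∫ s in r..(1:ℝ), w s := by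
      intro g
      have e1 : ∫ r in (0:ℝ)..1, g r * F r = inner ℝ w (T g) := hw g
      have e2 : inner ℝ w (T g) = ∫ s in (0:ℝ)..1, w s * ∫ r in (0:ℝ)..s, g r := by
        rw [L2.inner_def, intervalIntegral.integral_of_le zero_le_one, integral_Ioc_eq_integral_Ioo]
        refine integral_congr_ae ?_
        filter_upwards [(hmem _ (hφc g)).coeFn_toLp] with s hs
        change inner ℝ (w s) (((hmem _ (hφc g)).toLp _ : Lp ℝ 2 mu01) s) = _
        rw [hs]
        simp [mul_comm]
      rw [e1, e2]
      have t1 := tri_prod1 (hkint g)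
      have t2 := tri_prod2 (hkint g)
      rw [t1] at t2
      simp only [intervalIntegral.integral_const_mul, intervalIntegral.integral_mul_const] at t2
      rw [t2]
      congr 1; ext s; ring
    have hae := isOpen_Ioo.ae_eq_zero_of_integral_contDiff_smul_eq_zero (U := Set.Ioo (0:ℝ) 1) (μ := volume)
      (f := fun r => F r - ∫ s in r..(1:ℝ), w s) (hFint.sub hWint).locallyIntegrableOn (by
        intro g hg _ hsupp
        let g' : C(ℝ, ℝ) := ⟨g, hg.continuous⟩
        have := heq g'
        rw [← setIntegral_eq_integral_of_forall_compl_eq_zero (s := Set.Ioo (0:ℝ) 1), 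
          ← integral_Ioc_eq_integral_Ioo, ← intervalIntegral.integral_of_le zero_le_one]
        · have h3 : ∫ r in (0:ℝ)..1, g r • (F r - ∫ s in r..(1:ℝ), w s) =
              (∫ r in (0:ℝ)..1, g' r * F r) - ∫ r in (0:ℝ)..1, g' r * ∫ s in r..(1:ℝ), w s := by
            rw [← intervalIntegral.integral_sub (hgF g') (hgW g')]
            congr 1; ext r; simp [g', mul_sub]
          rw [h3, this, sub_self]
        · intro x hx
          have : g x = 0 := by
            by_contra hgx
            exact hx (hsupp (subset_tsupport g hgx))
          simp [this])
    rw [ae_restrict_iff' measurableSet_Ioo]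
    filter_upwards [hae] with t ht htm
    have := ht htm
    linarith

lemma gag_eq {γ : ℝ} {v u : ℝ → ℝ} (hu : Continuous u) (huv : ∀ x ∈ Set.Icc (0:ℝ) 1, u x = v x)
    (hi : IntegrableOn (fun p : ℝ × ℝ => (v p.1 - v p.2) ^ 2 / |p.1 - p.2| ^ (1 + 2 * γ))
        (Set.Ioo 0 1 ×ˢ Set.Ioo 0 1)) :
    GagL γ u ≤ ENNReal.ofReal (sobNorm γ v ^ 2) := by
  have hi' : IntegrableOn (fun p : ℝ × ℝ => (u p.1 - u p.2) ^ 2 / |p.1 - p.2| ^ (1 + 2 * γ))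
        (Set.Ioo 0 1 ×ˢ Set.Ioo 0 1) := by
    refine hi.congr_fun (fun p hp => ?_) (measurableSet_Ioo.prod measurableSet_Ioo)
    try simp only
    rw [huv _ (Set.Ioo_subset_Icc_self hp.1), huv _ (Set.Ioo_subset_Icc_self hp.2)]
  have hi2 : Integrable (fun p : ℝ × ℝ => (u p.1 - u p.2) ^ 2 / |p.1 - p.2| ^ (1 + 2 * γ))
      ((volume.restrict (Set.Ioo (0:ℝ) 1)).prod (volume.restrict (Set.Ioo (0:ℝ) 1))) := by
    rw [Measure.prod_restrict]; exact hi'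
  have hum := hu.measurable
  have e1 : GagL γ u = ENNReal.ofReal (∫ s in Set.Ioo (0 : ℝ) 1, ∫ t in Set.Ioo (0 : ℝ) 1,
      (u s - u t) ^ 2 / |s - t| ^ (1 + 2 * γ)) := by
    rw [← integral_prod _ hi2, ofReal_integral_eq_lintegral_ofReal hi2
      (Filter.Eventually.of_forall fun p => by simp only [Pi.zero_apply]; positivity),
      lintegral_prod _ (by fun_prop)]
    rfl
  have e2 : ∫ s in Set.Ioo (0 : ℝ) 1, ∫ t in Set.Ioo (0 : ℝ) 1,
      (u s - u t) ^ 2 / |s - t| ^ (1 + 2 * γ) = gagliardoSemi γ v ^ 2 := by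
    rw [gagliardoSemi, Real.sq_sqrt]
    · refine setIntegral_congr_fun measurableSet_Ioo fun s hs => ?_
      refine setIntegral_congr_fun measurableSet_Ioo fun t ht => ?_
      try simp only
      rw [huv _ (Set.Ioo_subset_Icc_self hs), huv _ (Set.Ioo_subset_Icc_self ht)]
    · exact integral_nonneg fun s => integral_nonneg fun t => by
        simp only [Pi.zero_apply]; positivity
  rw [e1, e2]
  apply ENNReal.ofReal_le_ofReal
  have : 0 ≤ ∫ s in Set.Ioo (0 : ℝ) 1, (v s) ^ 2 := integral_nonneg fun s => sq_nonneg _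
  rw [sobNorm, Real.sq_sqrt (by positivity)]
  linarith

/-- Second part of the paper's Lemma A.3: for `1/2 < γ < 1` and `v` continuous on `[0,1]`
with `v 1 = 0` and finite Gagliardo `H^γ(0,1)` norm, the right Riemann–Liouville derivative
`D_{1-}^γ v` exists in `L²(0,1)` with `‖D_{1-}^γ v‖_{L²(0,1)} ≤ C_γ ‖v‖_{H^γ(0,1)}`. -/
theorem stmt_3 (γ : ℝ) (hγ1 : 1 / 2 < γ) (hγ2 : γ < 1) :
    ∃ C : ℝ, 0 < C ∧ ∀ v : ℝ → ℝ,
      ContinuousOn v (Set.Icc 0 1) → v 1 = 0 →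
      IntegrableOn (fun p : ℝ × ℝ => (v p.1 - v p.2) ^ 2 / |p.1 - p.2| ^ (1 + 2 * γ))
        (Set.Ioo 0 1 ×ˢ Set.Ioo 0 1) →
      ∃ w : ℝ → ℝ, Measurable w ∧ IntegrableOn (fun s => (w s) ^ 2) (Set.Ioo 0 1) ∧
        Real.sqrt (∫ s in Set.Ioo (0 : ℝ) 1, (w s) ^ 2) ≤ C * sobNorm γ v ∧
        ∀ᵐ t ∂(volume.restrict (Set.Ioo (0 : ℝ) 1)),
          rightFracInt (1 - γ) v t = ∫ s in t..(1 : ℝ), w s := by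
  have hG : 0 < Real.Gamma (1 - γ) := Real.Gamma_pos_of_pos (by linarith)
  refine ⟨(Real.Gamma (1 - γ))⁻¹ * cTwo γ, mul_pos (inv_pos.2 hG) (cTwo_pos hγ1 hγ2), ?_⟩
  intro v hv h0 hi
  let u : ℝ → ℝ := Set.IccExtend (zero_le_one (α := ℝ)) ((Set.Icc (0:ℝ) 1).restrict v)
  have hu : Continuous u := (continuousOn_iff_continuous_restrict.1 hv).Icc_extend'
  have huv : ∀ x ∈ Set.Icc (0:ℝ) 1, u x = v x := by
    intro x hx
    change Set.IccExtend _ _ x = _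
    rw [Set.IccExtend_of_mem _ _ hx]; rfl
  have hu1 : u 1 = 0 := by rw [huv 1 (by simp), h0]
  obtain ⟨w, hwm, hwi, hwn, hw⟩ := core hγ1 hγ2 hu hu1 (Real.sqrt_nonneg _) (gag_eq hu huv hi)
  refine ⟨fun s => (Real.Gamma (1 - γ))⁻¹ * w s, hwm.const_mul _, ?_, ?_, ?_⟩
  · simp only [mul_pow]
    exact Integrable.const_mul hwi _
  · simp only [mul_pow]
    rw [integral_const_mul, Real.sqrt_mul (by positivity), Real.sqrt_sq (by positivity), mul_assoc]
    exact mul_le_mul_of_nonneg_left hwn (by positivity)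
  · rw [ae_restrict_iff' measurableSet_Ioo] at hw ⊢
    filter_upwards [hw] with t ht htm
    rw [rightFracInt, intervalIntegral.integral_const_mul, ← ht htm]
    congr 1
    refine intervalIntegral.integral_congr fun s hs => ?_
    rw [Set.uIcc_of_le htm.2.le] at hs
    have e : 1 - γ - 1 = -γ := by ring
    try simp only
    rw [huv s ⟨htm.1.le.trans hs.1, hs.2⟩, e]
end

section
/- Let 1/2 < γ < 1 and let v : [0,1] → ℝ be absolutely continuous with v(0) = 0 and v' ∈ L²(0,1). Then there exist constants c_γ > 0 and C_γ > 0 depending only on γ such that c_γ ‖v‖_{H^γ(0,1)} ≤ ‖I_{0+}^{1−γ} v'‖_{L²(0,1)} and ‖I_{0+}^{1−γ} v'‖²_{L²(0,1)} ≤ C_γ ∫_0^1 (I_{0+}^{2−2γ} v')(t) · v'(t) dt. -/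
open MeasureTheory

/-- Left Riemann–Liouville fractional integral:
`(I_{0+}^γ v)(t) = (1/Γ(γ)) ∫_0^t (t-s)^(γ-1) v(s) ds`. -/
noncomputable def leftFracInt (γ : ℝ) (v : ℝ → ℝ) (t : ℝ) : ℝ :=
  (Real.Gamma γ)⁻¹ * ∫ s in (0 : ℝ)..t, (t - s) ^ (γ - 1) * v s

open Set

/-- Abstract quadratic-form Fubini lemma. -/
lemma quad_fubini {Ω : Type*} [MeasurableSpace Ω] (μ : Measure Ω) [SFinite μ]
    (φ : Ω → ℝ → ℝ) (hφm : Measurable (Function.uncurry φ)) (hφ0 : ∀ w x, 0 ≤ φ w x)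
    (K : ℝ → ℝ → ℝ) (hK0 : ∀ x y, 0 ≤ K x y)
    (c : ℝ) (hc : 0 ≤ c)
    (hφ : ∀ x y, x ≠ y → ∫⁻ w, ENNReal.ofReal (φ w x * φ w y) ∂μ = ENNReal.ofReal (c * K x y))
    (G : ℝ → ℝ) (hG : Measurable G)
    (hQ : ∫⁻ x, ∫⁻ y, ENNReal.ofReal (K x y) * (‖G x‖ₑ * ‖G y‖ₑ) < ⊤) :
    Integrable (fun w => (∫ x, φ w x * G x) ^ 2) μ ∧
    ∫ w, (∫ x, φ w x * G x) ^ 2 ∂μ = c * ∫ z : ℝ × ℝ, K z.1 z.2 * (G z.1 * G z.2) := by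
  have hne : ∀ᵐ z : ℝ × ℝ, z.1 ≠ z.2 := by
    have hm : MeasurableSet {z : ℝ × ℝ | z.1 ≠ z.2} :=
      (measurableSet_eq_fun measurable_fst measurable_snd).compl
    rw [Measure.volume_eq_prod, Measure.ae_prod_iff_ae_ae hm]
    refine Filter.Eventually.of_forall fun x => ?_
    have : ∀ᵐ y : ℝ, y ≠ x := by simp [ae_iff, measure_singleton]
    filter_upwards [this] with y hy using hy.symm
  have hm1 : Measurable fun p : Ω × (ℝ × ℝ) => φ p.1 p.2.1 :=
    hφm.comp (measurable_fst.prodMk measurable_snd.fst)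
  have hm2 : Measurable fun p : Ω × (ℝ × ℝ) => φ p.1 p.2.2 :=
    hφm.comp (measurable_fst.prodMk measurable_snd.snd)
  have hg1 : Measurable fun p : Ω × (ℝ × ℝ) => G p.2.1 := hG.comp measurable_snd.fst
  have hg2 : Measurable fun p : Ω × (ℝ × ℝ) => G p.2.2 := hG.comp measurable_snd.snd
  set F : Ω × (ℝ × ℝ) → ℝ := fun p => (φ p.1 p.2.1 * G p.2.1) * (φ p.1 p.2.2 * G p.2.2) with hF
  have hFm : Measurable F := (hm1.mul hg1).mul (hm2.mul hg2)
  have hnorm : ∀ p : Ω × (ℝ × ℝ), ‖F p‖ₑ =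
      ENNReal.ofReal (φ p.1 p.2.1 * φ p.1 p.2.2) * (‖G p.2.1‖ₑ * ‖G p.2.2‖ₑ) := by
    intro p
    simp only [hF, enorm_mul]
    rw [Real.enorm_of_nonneg (hφ0 _ _), Real.enorm_of_nonneg (hφ0 _ _),
      ENNReal.ofReal_mul (hφ0 _ _)]
    ring
  have hin : ∀ z : ℝ × ℝ, z.1 ≠ z.2 → ∫⁻ w, ‖F (w, z)‖ₑ ∂μ =
      ENNReal.ofReal c * (ENNReal.ofReal (K z.1 z.2) * (‖G z.1‖ₑ * ‖G z.2‖ₑ)) := by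
    intro z hz
    simp only [hnorm]
    rw [lintegral_mul_const, hφ _ _ hz, ENNReal.ofReal_mul hc, mul_assoc]
    exact ((hm1.mul hm2).comp (measurable_id.prodMk measurable_const)).ennreal_ofReal
  have hFi : Integrable F (μ.prod volume) := by
    refine ⟨hFm.aestronglyMeasurable, ?_⟩
    rw [hasFiniteIntegral_iff_enorm, lintegral_prod_symm' _ hFm.enorm]
    rw [lintegral_congr_ae (g := fun z : ℝ × ℝ => ENNReal.ofReal c *
      (ENNReal.ofReal (K z.1 z.2) * (‖G z.1‖ₑ * ‖G z.2‖ₑ)))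
      (by filter_upwards [hne] with z hz using hin z hz)]
    rw [lintegral_const_mul' _ _ ENNReal.ofReal_ne_top]
    refine ENNReal.mul_lt_top ENNReal.ofReal_lt_top (lt_of_le_of_lt ?_ hQ)
    rw [Measure.volume_eq_prod]
    exact lintegral_prod_le _
  have hsq : ∀ w, ∫ z : ℝ × ℝ, F (w, z) = (∫ x, φ w x * G x) ^ 2 := by
    intro w
    rw [Measure.volume_eq_prod, sq]
    exact integral_prod_mul (fun x => φ w x * G x) (fun x => φ w x * G x)
  refine ⟨?_, ?_⟩
  · have := hFi.integral_prod_left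
    simpa only [hsq] using this
  · have h1 := integral_prod F hFi
    have h2 := integral_prod_symm F hFi
    simp only [hsq] at h1
    rw [← h1, h2, ← integral_const_mul]
    refine integral_congr_ae ?_
    filter_upwards [hne] with z hz
    have : ∀ w, F (w, z) = (φ w z.1 * φ w z.2) * (G z.1 * G z.2) := by
      intro w; simp only [hF]; ring
    simp only [this]
    rw [integral_mul_const, integral_eq_lintegral_of_nonneg_ae, hφ _ _ hz,
      ENNReal.toReal_ofReal (mul_nonneg hc (hK0 _ _)), mul_assoc]
    · exact Filter.Eventually.of_forall fun w => mul_nonneg (hφ0 _ _) (hφ0 _ _)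
    · exact ((hm1.mul hm2).comp (measurable_id.prodMk measurable_const)).aestronglyMeasurable

/-- Tonelli version. -/
lemma quad_tonelli {Ω : Type*} [MeasurableSpace Ω] (μ : Measure Ω) [SFinite μ]
    (φ : Ω → ℝ → ℝ) (hφm : Measurable (Function.uncurry φ)) (hφ0 : ∀ w x, 0 ≤ φ w x)
    (K : ℝ → ℝ → ℝ) 
    (c : ℝ) (hc : 0 ≤ c)
    (hφ : ∀ x y, x ≠ y → ∫⁻ w, ENNReal.ofReal (φ w x * φ w y) ∂μ = ENNReal.ofReal (c * K x y))
    (G : ℝ → ℝ) (hG : Measurable G) :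
    ∫⁻ w, (∫⁻ x, ENNReal.ofReal (φ w x) * ‖G x‖ₑ) ^ 2 ∂μ =
      ENNReal.ofReal c * ∫⁻ x, ∫⁻ y, ENNReal.ofReal (K x y) * (‖G x‖ₑ * ‖G y‖ₑ) := by
  have hp1 : ∀ w, Measurable fun x => ENNReal.ofReal (φ w x) * ‖G x‖ₑ := fun w =>
    (hφm.comp (measurable_const.prodMk measurable_id)).ennreal_ofReal.mul hG.enorm
  have hm0 : Measurable fun p : Ω × ℝ => ENNReal.ofReal (φ p.1 p.2) * ‖G p.2‖ₑ :=
    hφm.ennreal_ofReal.mul (hG.comp measurable_snd).enorm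
  have hm1 : Measurable fun p : (Ω × ℝ) × ℝ => (ENNReal.ofReal (φ p.1.1 p.1.2) * ‖G p.1.2‖ₑ) *
      (ENNReal.ofReal (φ p.1.1 p.2) * ‖G p.2‖ₑ) :=
    (hm0.comp measurable_fst).mul (hm0.comp (measurable_fst.fst.prodMk measurable_snd))
  have e1 : ∀ w, (∫⁻ x, ENNReal.ofReal (φ w x) * ‖G x‖ₑ) ^ 2 =
      ∫⁻ x, ∫⁻ y, (ENNReal.ofReal (φ w x) * ‖G x‖ₑ) * (ENNReal.ofReal (φ w y) * ‖G y‖ₑ) := by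
    intro w
    rw [sq, ← lintegral_mul_const _ (hp1 w)]
    refine lintegral_congr fun x => ?_
    rw [lintegral_const_mul _ (hp1 w)]
  simp only [e1]
  rw [lintegral_lintegral_swap hm1.lintegral_prod_right'.aemeasurable,
    ← lintegral_const_mul' _ _ ENNReal.ofReal_ne_top]
  refine lintegral_congr fun x => ?_
  have hm2 : Measurable fun p : Ω × ℝ => (ENNReal.ofReal (φ p.1 x) * ‖G x‖ₑ) *
      (ENNReal.ofReal (φ p.1 p.2) * ‖G p.2‖ₑ) :=
    hm1.comp ((measurable_fst.prodMk measurable_const).prodMk measurable_snd)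
  rw [lintegral_lintegral_swap hm2.aemeasurable, ← lintegral_const_mul' _ _ ENNReal.ofReal_ne_top]
  have : ∀ᵐ y : ℝ, y ≠ x := by simp [ae_iff, measure_singleton]
  refine lintegral_congr_ae ?_
  filter_upwards [this] with y hy
  have e2 : ∀ w, (ENNReal.ofReal (φ w x) * ‖G x‖ₑ) * (ENNReal.ofReal (φ w y) * ‖G y‖ₑ) =
      ENNReal.ofReal (φ w x * φ w y) * (‖G x‖ₑ * ‖G y‖ₑ) := by
    intro w
    rw [ENNReal.ofReal_mul (hφ0 _ _)]; ring
  simp only [e2]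
  rw [lintegral_mul_const, hφ _ _ hy.symm, ENNReal.ofReal_mul hc, mul_assoc]
  exact ((hφm.comp (measurable_id.prodMk measurable_const)).mul
    (hφm.comp (measurable_id.prodMk measurable_const))).ennreal_ofReal

noncomputable def ker (γ u x : ℝ) : ℝ := if x < u then (u - x) ^ (-γ) else 0

lemma ker_nonneg (γ u x : ℝ) : 0 ≤ ker γ u x := by
  unfold ker; split_ifs with h
  · exact Real.rpow_nonneg (by linarith) _
  · exact le_rfl

lemma ker_meas (γ : ℝ) : Measurable (Function.uncurry (ker γ)) := by
  unfold Function.uncurry ker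
  refine Measurable.ite (measurableSet_lt measurable_snd measurable_fst) ?_ measurable_const
  exact (measurable_fst.sub measurable_snd).pow_const _

noncomputable def seg (γ : ℝ) (w : ℝ × ℝ) (x : ℝ) : ℝ :=
  if w.1 < x ∧ x < w.2 then (w.2 - w.1) ^ (-(1 + 2 * γ) / 2) else 0

lemma seg_nonneg (γ : ℝ) (w : ℝ × ℝ) (x : ℝ) : 0 ≤ seg γ w x := by
  unfold seg; split_ifs with h
  · exact Real.rpow_nonneg (by linarith [h.1, h.2]) _
  · exact le_rfl

lemma seg_meas (γ : ℝ) : Measurable (Function.uncurry (seg γ)) := by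
  unfold Function.uncurry seg
  refine Measurable.ite ?_ ?_ measurable_const
  · exact (measurableSet_lt measurable_fst.fst measurable_snd).inter
      (measurableSet_lt measurable_snd measurable_fst.snd)
  · exact (measurable_fst.snd.sub measurable_fst.fst).pow_const _

noncomputable def bet (γ e : ℝ) : ℝ := ∫ r in Ioi (0:ℝ), r ^ (-γ) * (1 + r) ^ (-e)

lemma bet_int {γ e : ℝ} (h1 : γ < 1) (he : 0 < e) (h2 : 1 < γ + e) :
    IntegrableOn (fun r : ℝ => r ^ (-γ) * (1 + r) ^ (-e)) (Ioi 0) := by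
  have hm : ∀ s : Set ℝ, AEStronglyMeasurable (fun r : ℝ => r ^ (-γ) * (1 + r) ^ (-e))
      (volume.restrict s) := fun s => 
    ((measurable_id.pow_const _).mul ((measurable_const.add measurable_id).pow_const _)).aestronglyMeasurable
  rw [← Ioc_union_Ioi_eq_Ioi (zero_le_one (α := ℝ))]
  refine IntegrableOn.union ?_ ?_
  · have : IntegrableOn (fun r : ℝ => r ^ (-γ)) (Ioc 0 1) := by
      rw [← intervalIntegrable_iff_integrableOn_Ioc_of_le zero_le_one]
      exact intervalIntegral.intervalIntegrable_rpow' (by linarith)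
    refine Integrable.mono' this (hm _) ?_
    filter_upwards [ae_restrict_mem measurableSet_Ioc] with r hr
    have p1 : 0 ≤ r ^ (-γ) := Real.rpow_nonneg hr.1.le _
    have p2 : (1 + r) ^ (-e) ≤ 1 := Real.rpow_le_one_of_one_le_of_nonpos (by linarith [hr.1]) (by linarith)
    have p3 : 0 ≤ (1 + r) ^ (-e) := Real.rpow_nonneg (by linarith [hr.1]) _
    rw [Real.norm_of_nonneg (mul_nonneg p1 p3)]
    exact mul_le_of_le_one_right p1 p2
  · have : IntegrableOn (fun r : ℝ => r ^ (-(γ + e))) (Ioi 1) :=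
      integrableOn_Ioi_rpow_of_lt (by linarith) one_pos
    refine Integrable.mono' this (hm _) ?_
    filter_upwards [ae_restrict_mem measurableSet_Ioi] with r hr
    have hr : 1 < r := hr
    have p1 : 0 ≤ r ^ (-γ) := Real.rpow_nonneg (by linarith) _
    have p2 : (1 + r) ^ (-e) ≤ r ^ (-e) := Real.rpow_le_rpow_of_nonpos (by linarith) (by linarith) (by linarith)
    have p3 : 0 ≤ (1 + r) ^ (-e) := Real.rpow_nonneg (by linarith) _
    rw [Real.norm_of_nonneg (mul_nonneg p1 p3), neg_add, Real.rpow_add (by linarith)]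
    gcongr

lemma bet_pos {γ e : ℝ} (h1 : γ < 1) (he : 0 < e) (h2 : 1 < γ + e) : 0 < bet γ e := by
  unfold bet
  have hp : ∀ r ∈ Ioi (0:ℝ), 0 < r ^ (-γ) * (1 + r) ^ (-e) := fun r hr => by
    have hr : 0 < r := hr
    positivity
  rw [setIntegral_pos_iff_support_of_nonneg_ae _ (bet_int h1 he h2)]
  · have : Function.support (fun r : ℝ => r ^ (-γ) * (1 + r) ^ (-e)) ∩ Ioi 0 = Ioi 0 := by
      ext r; simp only [mem_inter_iff, Function.mem_support, and_iff_right_iff_imp]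
      exact fun hr => (hp r hr).ne'
    rw [this]; simp
  · filter_upwards [ae_restrict_mem measurableSet_Ioi] with r hr using (hp r hr).le

lemma bet_lint {γ e : ℝ} (h1 : γ < 1) (he : 0 < e) (h2 : 1 < γ + e) :
    ∫⁻ r in Ioi (0:ℝ), ENNReal.ofReal (r ^ (-γ) * (1 + r) ^ (-e)) = ENNReal.ofReal (bet γ e) := by
  rw [bet, ofReal_integral_eq_lintegral_ofReal (bet_int h1 he h2)]
  filter_upwards [ae_restrict_mem measurableSet_Ioi] with r hr
  have hr : 0 < r := hr
  show 0 ≤ r ^ (-γ) * (1 + r) ^ (-e)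
  positivity

lemma ker_pair_lt {γ : ℝ} (h0 : 1 / 2 < γ) (h1 : γ < 1) {x y : ℝ} (hxy : x < y) :
    ∫⁻ u, ENNReal.ofReal (ker γ u x * ker γ u y) =
      ENNReal.ofReal (bet γ γ * |x - y| ^ (1 - 2 * γ)) := by
  have hd : 0 < y - x := by linarith
  have e0 : ∀ u, ENNReal.ofReal (ker γ u x * ker γ u y) =
      (Ioi y).indicator (fun u => ENNReal.ofReal ((u - x) ^ (-γ) * (u - y) ^ (-γ))) u := by
    intro u
    by_cases hu : y < u
    · rw [indicator_of_mem (show u ∈ Ioi y from hu), ker, ker, if_pos hu, if_pos (by linarith)]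
    · rw [indicator_of_notMem (show u ∉ Ioi y from hu)]; simp [ker, hu]
  simp only [e0]
  rw [lintegral_indicator measurableSet_Ioi]
  have himg : (fun r : ℝ => y + (y - x) * r) '' Ioi 0 = Ioi y := by
    ext u; simp only [mem_image, mem_Ioi]
    constructor
    · rintro ⟨r, hr, rfl⟩; nlinarith [mul_pos hd hr]
    · intro hu
      exact ⟨(u - y) / (y - x), div_pos (by linarith) hd, by field_simp; ring⟩
  rw [← himg, lintegral_image_eq_lintegral_abs_deriv_mul measurableSet_Ioi
    (f' := fun _ => y - x) (fun r _ => by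
      simpa using (((hasDerivAt_id r).const_mul (y - x)).const_add y).hasDerivWithinAt)
    (fun a _ b _ hab => by simpa [hd.ne'] using hab)]
  have hcg : ∀ r ∈ Ioi (0:ℝ), ENNReal.ofReal |y - x| * ENNReal.ofReal ((y + (y - x) * r - x) ^ (-γ) *
      (y + (y - x) * r - y) ^ (-γ)) = ENNReal.ofReal ((y - x) ^ (1 - 2 * γ)) * 
      ENNReal.ofReal (r ^ (-γ) * (1 + r) ^ (-γ)) := by
    intro r hr
    have hr : 0 < r := hr
    rw [← ENNReal.ofReal_mul (abs_nonneg _), ← ENNReal.ofReal_mul (by positivity), abs_of_pos hd]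
    congr 1
    have a1 : y + (y - x) * r - x = (y - x) * (1 + r) := by ring
    have a2 : y + (y - x) * r - y = (y - x) * r := by ring
    rw [a1, a2, Real.mul_rpow hd.le (by positivity), Real.mul_rpow hd.le hr.le]
    have : (y - x) ^ (1 - 2 * γ) = (y - x) * (y - x) ^ (-γ) * (y - x) ^ (-γ) := by
      rw [show 1 - 2 * γ = 1 + -γ + -γ by ring, Real.rpow_add hd, Real.rpow_add hd, Real.rpow_one]
    rw [this]; ring
  rw [setLIntegral_congr_fun measurableSet_Ioi hcg, lintegral_const_mul' _ _ ENNReal.ofReal_ne_top,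
    bet_lint h1 (by linarith) (by linarith), ← ENNReal.ofReal_mul (by positivity), mul_comm,
    abs_sub_comm, abs_of_pos hd]

lemma ker_pair {γ : ℝ} (h0 : 1 / 2 < γ) (h1 : γ < 1) (x y : ℝ) (hxy : x ≠ y) :
    ∫⁻ u, ENNReal.ofReal (ker γ u x * ker γ u y) =
      ENNReal.ofReal (bet γ γ * |x - y| ^ (1 - 2 * γ)) := by
  rcases lt_or_gt_of_ne hxy with h | h
  · exact ker_pair_lt h0 h1 h
  · have := ker_pair_lt h0 h1 h
    rw [abs_sub_comm, ← this]
    simp only [mul_comm]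

lemma tail_lint {s a b : ℝ} (hs : 1 < s) (hab : b < a) :
    ∫⁻ q in Ioi a, ENNReal.ofReal ((q - b) ^ (-s)) = ENNReal.ofReal ((a - b) ^ (1 - s) / (s - 1)) := by
  have himg : (fun r : ℝ => r + b) '' Ioi (a - b) = Ioi a := by simp
  have key : ∫⁻ q in Ioi a, ENNReal.ofReal ((q - b) ^ (-s)) =
      ∫⁻ r in Ioi (a - b), ENNReal.ofReal (r ^ (-s)) := by
    rw [← himg, lintegral_image_eq_lintegral_abs_deriv_mul measurableSet_Ioi
      (f' := fun _ => 1) (fun r _ => by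
        simpa using ((hasDerivAt_id r).add_const b).hasDerivWithinAt)
      (fun a _ b _ hab => by simpa using hab)]
    simp
  have hp : 0 < a - b := by linarith
  rw [key, ← ofReal_integral_eq_lintegral_ofReal (integrableOn_Ioi_rpow_of_lt (by linarith) hp),
    integral_Ioi_rpow_of_lt (by linarith) hp]
  · congr 1
    rw [show -s + 1 = 1 - s by ring, show s - 1 = -(1 - s) by ring, div_neg, neg_div]
  · filter_upwards [ae_restrict_mem measurableSet_Ioi] with r hr
    have hr : a - b < r := hr
    exact Real.rpow_nonneg (by linarith) _

lemma seg_pair_lt {γ : ℝ} (h0 : 1 / 2 < γ) {x y : ℝ} (hxy : x < y) :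
    ∫⁻ w : ℝ × ℝ, ENNReal.ofReal (seg γ w x * seg γ w y) =
      ENNReal.ofReal ((2 * γ * (2 * γ - 1))⁻¹ * |x - y| ^ (1 - 2 * γ)) := by
  have hm : Measurable fun w : ℝ × ℝ => ENNReal.ofReal (seg γ w x * seg γ w y) :=
    (((seg_meas γ).comp (measurable_id.prodMk measurable_const)).mul
      ((seg_meas γ).comp (measurable_id.prodMk measurable_const))).ennreal_ofReal
  rw [Measure.volume_eq_prod, lintegral_prod _ hm.aemeasurable]
  have e0 : ∀ p q : ℝ, ENNReal.ofReal (seg γ (p, q) x * seg γ (p, q) y) =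
      (Iio x).indicator (fun p => (Ioi y).indicator
        (fun q => ENNReal.ofReal ((q - p) ^ (-(1 + 2 * γ)))) q) p := by
    intro p q
    by_cases hp : p < x
    · rw [indicator_of_mem (show p ∈ Iio x from hp)]
      by_cases hq : y < q
      · rw [indicator_of_mem (show q ∈ Ioi y from hq), seg, seg, if_pos ⟨hp, by simpa using hxy.trans hq⟩,
          if_pos ⟨by simpa using hp.trans hxy, hq⟩, ← Real.rpow_add (by simp; linarith)]
        congr 2; ring
      · rw [indicator_of_notMem (show q ∉ Ioi y from hq)]; simp [seg, hq]
    · rw [indicator_of_notMem (show p ∉ Iio x from hp)]; simp [seg, hp]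
  have e1 : ∀ p : ℝ, ∫⁻ q, ENNReal.ofReal (seg γ (p, q) x * seg γ (p, q) y) =
      (Iio x).indicator (fun p => ENNReal.ofReal ((2 * γ)⁻¹ * (y - p) ^ (-(2 * γ)))) p := by
    intro p
    simp only [e0]
    by_cases hp : p < x
    · simp only [indicator_of_mem (show p ∈ Iio x from hp)]
      rw [lintegral_indicator measurableSet_Ioi, tail_lint (by linarith) (by linarith)]
      congr 1
      rw [show 1 - (1 + 2 * γ) = -(2 * γ) by ring, show 1 + 2 * γ - 1 = 2 * γ by ring]; ring
    · simp only [indicator_of_notMem (show p ∉ Iio x from hp)]; simp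
  simp only [e1]
  rw [lintegral_indicator measurableSet_Iio]
  have himg : (fun r : ℝ => -r) '' Ioi (-x) = Iio x := by simp
  rw [← himg, lintegral_image_eq_lintegral_abs_deriv_mul measurableSet_Ioi
      (f' := fun _ => -1) (fun r _ => by
        exact (hasDerivAt_neg r).hasDerivWithinAt)
      (fun a _ b _ hab => by simpa using hab)]
  have : ∀ r : ℝ, ENNReal.ofReal |(-1:ℝ)| * ENNReal.ofReal ((2 * γ)⁻¹ * (y - -r) ^ (-(2 * γ))) =
      ENNReal.ofReal ((2 * γ)⁻¹) * ENNReal.ofReal ((r - (-y)) ^ (-(2 * γ))) := by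
    intro r
    rw [ENNReal.ofReal_mul (by positivity)]; simp [add_comm]
  simp only [this]
  rw [lintegral_const_mul' _ _ ENNReal.ofReal_ne_top, tail_lint (by linarith) (by linarith),
    ← ENNReal.ofReal_mul (by positivity), abs_sub_comm, abs_of_pos (by linarith : 0 < y - x)]
  congr 1
  rw [mul_inv (2 * γ) (2 * γ - 1), div_eq_mul_inv, show -x - -y = y - x by ring]; ring

lemma seg_pair {γ : ℝ} (h0 : 1 / 2 < γ) (x y : ℝ) (hxy : x ≠ y) :
    ∫⁻ w : ℝ × ℝ, ENNReal.ofReal (seg γ w x * seg γ w y) =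
      ENNReal.ofReal ((2 * γ * (2 * γ - 1))⁻¹ * |x - y| ^ (1 - 2 * γ)) := by
  rcases lt_or_gt_of_ne hxy with h | h
  · exact seg_pair_lt h0 h
  · have := seg_pair_lt h0 h
    rw [abs_sub_comm, ← this]
    simp only [mul_comm]

/-- Balayage kernel. -/
noncomputable def bal (γ s t : ℝ) : ℝ := (t - 1) ^ (γ - 1) * (1 - s) ^ (1 - γ) / (t - s)

lemma bal_id {γ : ℝ} (h0 : 1 / 2 < γ) (h1 : γ < 1) {s u : ℝ} (hs : s < 1) (hu : 1 < u) :
    ∫⁻ t in Ioo 1 u, ENNReal.ofReal ((u - t) ^ (-γ) * bal γ s t) =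
      ENNReal.ofReal (bet γ 1 * (u - s) ^ (-γ)) := by
  have hus : 0 < u - s := by linarith
  have hs' : 0 < 1 - s := by linarith
  have hu' : 0 < u - 1 := by linarith
  set f : ℝ → ℝ := fun t => (u - t) * (1 - s) / ((t - 1) * (u - s)) with hf
  have himg : f '' Ioo 1 u = Ioi 0 := by
    ext r; simp only [mem_image, mem_Ioi, hf, mem_Ioo]
    constructor
    · rintro ⟨t, ht, rfl⟩
      have a1 : 0 < u - t := by linarith [ht.2]
      have a2 : 0 < t - 1 := by linarith [ht.1]
      positivity
    · intro hr
      have hd : 0 < r * (u - s) + (1 - s) := by positivity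
      refine ⟨(r * (u - s) + u * (1 - s)) / (r * (u - s) + (1 - s)), ⟨?_, ?_⟩, ?_⟩
      · rw [lt_div_iff₀ hd]; nlinarith
      · rw [div_lt_iff₀ hd]; nlinarith [mul_pos hr hus, mul_pos (mul_pos hr hus) hu']
      · have b1 : u - (r * (u - s) + u * (1 - s)) / (r * (u - s) + (1 - s)) =
            (u - 1) * (r * (u - s)) / (r * (u - s) + (1 - s)) := by field_simp; ring
        have b2 : (r * (u - s) + u * (1 - s)) / (r * (u - s) + (1 - s)) - 1 =
            (u - 1) * (1 - s) / (r * (u - s) + (1 - s)) := by field_simp; ring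
        rw [b1, b2]; field_simp
  have hder : ∀ t ∈ Ioo 1 u, HasDerivWithinAt f
      (-((1 - s) * (u - 1) / ((u - s) * (t - 1) ^ 2))) (Ioo 1 u) t := by
    intro t ht
    have a2 : t - 1 ≠ 0 := by linarith [ht.1]
    have d1 : HasDerivAt (fun t => (u - t) * (1 - s)) (-1 * (1 - s)) t :=
      ((hasDerivAt_id t).const_sub u).mul_const _
    have d2 : HasDerivAt (fun t => (t - 1) * (u - s)) (1 * (u - s)) t :=
      ((hasDerivAt_id t).sub_const 1).mul_const _
    have := (d1.div d2 (mul_ne_zero a2 hus.ne')).hasDerivWithinAt (s := Ioo 1 u)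
    refine this.congr_deriv ?_
    field_simp; ring
  have hinj : InjOn f (Ioo 1 u) := by
    intro a ha b hb hab
    have a2 : 0 < a - 1 := by linarith [ha.1]
    have b2 : 0 < b - 1 := by linarith [hb.1]
    simp only [hf] at hab
    rw [div_eq_div_iff (by positivity) (by positivity)] at hab
    have : ((1 - s) * (u - s) * (u - 1)) * (a - b) = 0 := by linear_combination -hab
    have h3 : (1 - s) * (u - s) * (u - 1) ≠ 0 := by positivity
    have := (mul_eq_zero.mp this).resolve_left h3
    linarith
  have key := lintegral_image_eq_lintegral_abs_deriv_mul measurableSet_Ioo hder hinj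
    (fun r => ENNReal.ofReal (r ^ (-γ) * (1 + r) ^ (-(1:ℝ))))
  rw [himg, bet_lint h1 one_pos (by linarith)] at key
  rw [mul_comm, ENNReal.ofReal_mul (by positivity), key, ← lintegral_const_mul' _ _ ENNReal.ofReal_ne_top]
  refine setLIntegral_congr_fun measurableSet_Ioo fun t ht => ?_
  have a1 : 0 < u - t := by linarith [ht.2]
  have a2 : 0 < t - 1 := by linarith [ht.1]
  have a3 : 0 < t - s := by linarith
  have e1 : 1 + f t = (t - s) * (u - 1) / ((t - 1) * (u - s)) := by
    simp only [hf]; field_simp; ring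
  simp only [abs_neg]
  rw [abs_of_pos (by positivity), ← ENNReal.ofReal_mul (by positivity),
    ← ENNReal.ofReal_mul (by positivity), e1, Real.rpow_neg_one]
  congr 1
  simp only [hf, bal]
  rw [Real.div_rpow (by positivity) (by positivity), Real.mul_rpow a1.le hs'.le,
    Real.mul_rpow a2.le hus.le]
  have r1 : (t - 1) ^ (γ - 1) = ((t - 1) ^ (-γ))⁻¹ * (t - 1)⁻¹ := by
    rw [← Real.rpow_neg a2.le, ← Real.rpow_neg_one (t - 1), ← Real.rpow_add a2]; congr 1; ring
  have r2 : (1 - s) ^ (1 - γ) = (1 - s) * (1 - s) ^ (-γ) := by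
    rw [sub_eq_add_neg 1 γ, Real.rpow_add hs', Real.rpow_one]
  rw [r1, r2]
  have n1 : (t - 1) ^ (-γ) ≠ 0 := (Real.rpow_pos_of_pos a2 _).ne'
  have n2 : (u - s) ^ (-γ) ≠ 0 := (Real.rpow_pos_of_pos hus _).ne'
  field_simp

lemma bal_nonneg {γ s t : ℝ} (hs : s < 1) (ht : 1 < t) : 0 ≤ bal γ s t := by
  unfold bal
  have := Real.rpow_nonneg (show 0 ≤ t - 1 by linarith) (γ - 1)
  have := Real.rpow_nonneg (show 0 ≤ 1 - s by linarith) (1 - γ)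
  have : 0 ≤ t - s := by linarith
  positivity

lemma bal_meas (γ : ℝ) : Measurable fun p : ℝ × ℝ => bal γ p.2 p.1 := by
  unfold bal
  exact (((measurable_fst.sub_const 1).pow_const _).mul
    ((measurable_const.sub measurable_snd).pow_const _)).div (measurable_fst.sub measurable_snd)

lemma bal_ker {γ : ℝ} (h0 : 1 / 2 < γ) (h1 : γ < 1) {s u : ℝ} (hs : s < 1) (hu : 1 < u) :
    ∫⁻ t in Ioi 1, ENNReal.ofReal (ker γ u t * bal γ s t) =
      ENNReal.ofReal (bet γ 1 * ker γ u s) := by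
  have e : ker γ u s = (u - s) ^ (-γ) := by rw [ker, if_pos (by linarith)]
  rw [e, ← bal_id h0 h1 hs hu, ← lintegral_indicator measurableSet_Ioi,
    ← lintegral_indicator measurableSet_Ioo]
  refine lintegral_congr fun t => ?_
  by_cases ht : 1 < t
  · by_cases htu : t < u
    · rw [indicator_of_mem (show t ∈ Ioi 1 from ht), indicator_of_mem (show t ∈ Ioo 1 u from ⟨ht, htu⟩),
        ker, if_pos htu]
    · rw [indicator_of_mem (show t ∈ Ioi 1 from ht), indicator_of_notMem (fun h => htu h.2),
        ker, if_neg htu]; simp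
  · rw [indicator_of_notMem (show t ∉ Ioi 1 from ht), indicator_of_notMem (fun h => ht h.1)]

lemma bal_ker_le {γ : ℝ} (h0 : 1 / 2 < γ) (h1 : γ < 1) {s : ℝ} (u : ℝ) (hs : s < 1) :
    ∫⁻ t in Ioi 1, ENNReal.ofReal (ker γ u t * bal γ s t) ≤
      ENNReal.ofReal (bet γ 1 * ker γ u s) := by
  by_cases hu : 1 < u
  · exact (bal_ker h0 h1 hs hu).le
  · rw [setLIntegral_congr_fun (g := fun _ => 0) measurableSet_Ioi]
    · simp
    · intro t ht
      have ht : 1 < t := ht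
      simp only
      rw [ker, if_neg (by linarith)]; simp

noncomputable def tail (γ : ℝ) (g : ℝ → ℝ) (t : ℝ) : ℝ :=
  -(bet γ 1)⁻¹ * ∫ s, bal γ s t * g s

noncomputable def extn (γ : ℝ) (g : ℝ → ℝ) (t : ℝ) : ℝ :=
  g t + (Ioi (1:ℝ)).indicator (tail γ g) t

lemma tail_meas (γ : ℝ) {g : ℝ → ℝ} (hg : Measurable g) : Measurable (tail γ g) := by
  unfold tail
  refine Measurable.const_mul ?_ _
  have : StronglyMeasurable fun p : ℝ × ℝ => bal γ p.2 p.1 * g p.2 :=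
    ((bal_meas γ).mul (hg.comp measurable_snd)).stronglyMeasurable
  exact this.integral_prod_right'.measurable

lemma extn_meas (γ : ℝ) {g : ℝ → ℝ} (hg : Measurable g) : Measurable (extn γ g) :=
  hg.add ((tail_meas γ hg).indicator measurableSet_Ioi)

lemma tail_bd {γ : ℝ} (h0 : 1 / 2 < γ) (h1 : γ < 1) {g : ℝ → ℝ} (hg : Measurable g)
    (hgs : ∀ s, s ∉ Ioo (0:ℝ) 1 → g s = 0) (u : ℝ) :
    ∫⁻ t in Ioi 1, ∫⁻ s, ‖ker γ u t * (bal γ s t * g s)‖ₑ ≤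
      ENNReal.ofReal (bet γ 1) * ∫⁻ t, ENNReal.ofReal (ker γ u t) * ‖g t‖ₑ := by
  have hkm : Measurable (ker γ u) := (ker_meas γ).comp (measurable_const.prodMk measurable_id)
  have hm : Measurable fun p : ℝ × ℝ => ‖ker γ u p.1 * (bal γ p.2 p.1 * g p.2)‖ₑ :=
    ((hkm.comp measurable_fst).mul ((bal_meas γ).mul (hg.comp measurable_snd))).enorm
  rw [lintegral_lintegral_swap hm.aemeasurable, ← lintegral_const_mul' _ _ ENNReal.ofReal_ne_top]
  refine lintegral_mono fun s => ?_
  by_cases hs : s ∈ Ioo (0:ℝ) 1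
  · have e : ∀ t ∈ Ioi (1:ℝ), ‖ker γ u t * (bal γ s t * g s)‖ₑ =
        ENNReal.ofReal (ker γ u t * bal γ s t) * ‖g s‖ₑ := by
      intro t ht
      rw [← mul_assoc, enorm_mul, Real.enorm_of_nonneg
        (mul_nonneg (ker_nonneg _ _ _) (bal_nonneg hs.2 ht))]
    simp only
    rw [setLIntegral_congr_fun measurableSet_Ioi e, lintegral_mul_const' _ _ enorm_ne_top,
      ← mul_assoc, ← ENNReal.ofReal_mul (bet_pos h1 one_pos (by linarith)).le]
    gcongr
    exact bal_ker_le h0 h1 u hs.2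
  · simp [hgs s hs]

lemma extn_dom {γ : ℝ} (h0 : 1 / 2 < γ) (h1 : γ < 1) {g : ℝ → ℝ} (hg : Measurable g)
    (hgs : ∀ s, s ∉ Ioo (0:ℝ) 1 → g s = 0) (u : ℝ) :
    ∫⁻ t, ENNReal.ofReal (ker γ u t) * ‖extn γ g t‖ₑ ≤
      2 * ∫⁻ t, ENNReal.ofReal (ker γ u t) * ‖g t‖ₑ := by
  have hkm : Measurable (ker γ u) := (ker_meas γ).comp (measurable_const.prodMk measurable_id)
  have hA := bet_pos h1 one_pos (show 1 < γ + 1 by linarith)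
  have hle : ∀ t, ENNReal.ofReal (ker γ u t) * ‖extn γ g t‖ₑ ≤
      ENNReal.ofReal (ker γ u t) * ‖g t‖ₑ + (Ioi (1:ℝ)).indicator (fun t =>
        ENNReal.ofReal (bet γ 1)⁻¹ * ∫⁻ s, ‖ker γ u t * (bal γ s t * g s)‖ₑ) t := by
    intro t
    by_cases ht : t ∈ Ioi (1:ℝ)
    · rw [indicator_of_mem ht]
      calc ENNReal.ofReal (ker γ u t) * ‖extn γ g t‖ₑ 
          ≤ ENNReal.ofReal (ker γ u t) * (‖g t‖ₑ + ‖tail γ g t‖ₑ) := by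
            gcongr
            rw [extn, indicator_of_mem ht]
            exact enorm_add_le _ _
        _ ≤ _ := by
            rw [mul_add]
            refine add_le_add le_rfl ?_
            have e1 : ‖tail γ g t‖ₑ ≤ ENNReal.ofReal (bet γ 1)⁻¹ * ∫⁻ s, ‖bal γ s t * g s‖ₑ := by
              rw [tail, enorm_mul, enorm_neg, Real.enorm_of_nonneg (inv_nonneg.2 hA.le)]
              gcongr
              exact enorm_integral_le_lintegral_enorm _
            have e2 : ∫⁻ s, ‖ker γ u t * (bal γ s t * g s)‖ₑ =
                ENNReal.ofReal (ker γ u t) * ∫⁻ s, ‖bal γ s t * g s‖ₑ := by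
              simp only [enorm_mul (ker γ u t)]
              rw [lintegral_const_mul' _ _ enorm_ne_top, Real.enorm_of_nonneg (ker_nonneg _ _ _)]
            rw [e2, mul_left_comm]
            gcongr
    · rw [indicator_of_notMem ht, extn, indicator_of_notMem ht]; simp
  refine (lintegral_mono hle).trans ?_
  have hkg : Measurable fun t => ENNReal.ofReal (ker γ u t) * ‖g t‖ₑ :=
    hkm.ennreal_ofReal.mul hg.enorm
  rw [lintegral_add_left hkg, lintegral_indicator measurableSet_Ioi,
    lintegral_const_mul' _ _ ENNReal.ofReal_ne_top, two_mul]
  gcongr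
  calc _ ≤ ENNReal.ofReal (bet γ 1)⁻¹ * (ENNReal.ofReal (bet γ 1) *
        ∫⁻ t, ENNReal.ofReal (ker γ u t) * ‖g t‖ₑ) := by
        gcongr
        exact tail_bd h0 h1 hg hgs u
    _ = _ := by
        rw [← mul_assoc, ← ENNReal.ofReal_mul (inv_nonneg.2 hA.le), inv_mul_cancel₀ hA.ne']; simp

lemma extn_zero {γ : ℝ} (h0 : 1 / 2 < γ) (h1 : γ < 1) {g : ℝ → ℝ} (hg : Measurable g)
    (hgs : ∀ s, s ∉ Ioo (0:ℝ) 1 → g s = 0) {u : ℝ} (hu : 1 < u)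
    (hfin : ∫⁻ t, ENNReal.ofReal (ker γ u t) * ‖g t‖ₑ < ⊤) :
    ∫ t, ker γ u t * extn γ g t = 0 := by
  have hkm : Measurable (ker γ u) := (ker_meas γ).comp (measurable_const.prodMk measurable_id)
  have hA := bet_pos h1 one_pos (show 1 < γ + 1 by linarith)
  set F : ℝ × ℝ → ℝ := fun p => ker γ u p.1 * (bal γ p.2 p.1 * g p.2) with hF
  have hm : Measurable F :=
    ((hkm.comp measurable_fst).mul ((bal_meas γ).mul (hg.comp measurable_snd)))
  have hFi : Integrable F ((volume.restrict (Ioi 1)).prod volume) := by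
    refine ⟨hm.aestronglyMeasurable, ?_⟩
    rw [hasFiniteIntegral_iff_enorm]
    refine (lintegral_prod_le _).trans_lt ((tail_bd h0 h1 hg hgs u).trans_lt ?_)
    exact ENNReal.mul_lt_top ENNReal.ofReal_lt_top hfin
  have hgi : Integrable fun t => ker γ u t * g t := by
    refine ⟨(hkm.mul hg).aestronglyMeasurable, ?_⟩
    rw [hasFiniteIntegral_iff_enorm]
    simpa only [enorm_mul, Real.enorm_of_nonneg (ker_nonneg γ u _)] using hfin
  have ht1 : ∀ t, ker γ u t * tail γ g t = -(bet γ 1)⁻¹ * ∫ s, F (t, s) := by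
    intro t
    simp only [hF, tail]
    rw [integral_const_mul]; ring
  have hti : IntegrableOn (fun t => ker γ u t * tail γ g t) (Ioi 1) := by
    simp only [ht1]
    exact hFi.integral_prod_left.const_mul _
  have hE : ∀ t, ker γ u t * extn γ g t = ker γ u t * g t +
      (Ioi (1:ℝ)).indicator (fun t => ker γ u t * tail γ g t) t := by
    intro t
    by_cases ht : t ∈ Ioi (1:ℝ)
    · rw [extn, indicator_of_mem ht, indicator_of_mem ht]; ring
    · rw [extn, indicator_of_notMem ht, indicator_of_notMem ht]; ring
  simp only [hE]
  rw [integral_add hgi (hti.integrable_indicator measurableSet_Ioi),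
    integral_indicator measurableSet_Ioi]
  simp only [ht1]
  rw [integral_const_mul, ← integral_prod F hFi, integral_prod_symm F hFi]
  have hin : ∀ s, ∫ t in Ioi 1, F (t, s) = bet γ 1 * (ker γ u s * g s) := by
    intro s
    by_cases hs : s ∈ Ioo (0:ℝ) 1
    · have : ∀ t, F (t, s) = (ker γ u t * bal γ s t) * g s := by intro t; simp only [hF]; ring
      simp only [this]
      rw [integral_mul_const, integral_eq_lintegral_of_nonneg_ae, bal_ker h0 h1 hs.2 hu,
        ENNReal.toReal_ofReal (mul_nonneg hA.le (ker_nonneg _ _ _)), mul_assoc]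
      · filter_upwards [ae_restrict_mem measurableSet_Ioi] with t ht
        exact mul_nonneg (ker_nonneg _ _ _) (bal_nonneg hs.2 ht)
      · exact (hkm.mul ((bal_meas γ).comp (measurable_id.prodMk measurable_const))).aestronglyMeasurable
    · simp [hF, hgs s hs]
  simp only [hin]
  rw [integral_const_mul]
  field_simp
  ring

lemma Q_fin {γ : ℝ} (h0 : 1 / 2 < γ) (h1 : γ < 1) {g : ℝ → ℝ} (hg : Measurable g)
    (hgs : ∀ s, s ∉ Ioo (0:ℝ) 1 → g s = 0) (hg2 : Integrable fun t => g t ^ 2) :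
    ∫⁻ x, ∫⁻ y, ENNReal.ofReal (|x - y| ^ (1 - 2 * γ)) * (‖g x‖ₑ * ‖g y‖ₑ) < ⊤ := by
  set f : ℝ → ENNReal := (Ioo (0:ℝ) 1).indicator fun z => ENNReal.ofReal (z ^ (1 - 2 * γ)) with hf
  have hfm : Measurable f := (measurable_id.pow_const _).ennreal_ofReal.indicator measurableSet_Ioo
  have hff : ∫⁻ z, f z < ⊤ := by
    rw [hf, lintegral_indicator measurableSet_Ioo]
    have : IntegrableOn (fun r : ℝ => r ^ (1 - 2 * γ)) (Ioo 0 1) := by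
      refine IntegrableOn.mono_set ?_ Ioo_subset_Ioc_self
      rw [← intervalIntegrable_iff_integrableOn_Ioc_of_le zero_le_one]
      exact intervalIntegral.intervalIntegrable_rpow' (by linarith)
    exact this.lintegral_lt_top
  have hg2f : ∫⁻ x, ‖g x‖ₑ ^ 2 < ⊤ := by
    have := hg2.2
    rw [hasFiniteIntegral_iff_enorm] at this
    simpa only [enorm_pow] using this
  have hle : ∀ x y, ENNReal.ofReal (|x - y| ^ (1 - 2 * γ)) * (‖g x‖ₑ * ‖g y‖ₑ) ≤
      ((f (x - y) + f (y - x)) * ‖g x‖ₑ ^ 2) + ((f (x - y) + f (y - x)) * ‖g y‖ₑ ^ 2) := by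
    intro x y
    by_cases hx : x ∈ Ioo (0:ℝ) 1
    swap
    · simp [hgs x hx]
    by_cases hy : y ∈ Ioo (0:ℝ) 1
    swap
    · simp [hgs y hy]
    have k1 : ENNReal.ofReal (|x - y| ^ (1 - 2 * γ)) ≤ f (x - y) + f (y - x) := by
      rcases lt_trichotomy x y with h | h | h
      · refine le_add_of_nonneg_of_le zero_le ?_
        rw [hf, indicator_of_mem (show y - x ∈ Ioo (0:ℝ) 1 from ⟨by linarith, by linarith [hx.1, hy.2]⟩),
          abs_sub_comm, abs_of_pos (by linarith)]
      · subst h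
        rw [sub_self, abs_zero, Real.zero_rpow (by linarith)]; simp
      · refine le_add_of_le_of_nonneg ?_ zero_le 
        rw [hf, indicator_of_mem (show x - y ∈ Ioo (0:ℝ) 1 from ⟨by linarith, by linarith [hx.2, hy.1]⟩),
          abs_of_pos (by linarith)]
    rw [← mul_add]
    gcongr
    rcases le_total ‖g x‖ₑ ‖g y‖ₑ with h | h
    · refine le_add_of_nonneg_of_le zero_le ?_
      rw [sq]; gcongr
    · refine le_add_of_le_of_nonneg ?_ zero_le
      rw [sq]; gcongr
  have hm1 : Measurable fun p : ℝ × ℝ => (f (p.1 - p.2) + f (p.2 - p.1)) * ‖g p.1‖ₑ ^ 2 :=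
    ((hfm.comp (measurable_fst.sub measurable_snd)).add
      (hfm.comp (measurable_snd.sub measurable_fst))).mul ((hg.comp measurable_fst).enorm.pow_const 2)
  have hm2 : Measurable fun p : ℝ × ℝ => (f (p.1 - p.2) + f (p.2 - p.1)) * ‖g p.2‖ₑ ^ 2 :=
    ((hfm.comp (measurable_fst.sub measurable_snd)).add
      (hfm.comp (measurable_snd.sub measurable_fst))).mul ((hg.comp measurable_snd).enorm.pow_const 2)
  have c1 : ∀ x, ∫⁻ y, (f (x - y) + f (y - x)) = 2 * ∫⁻ z, f z := by
    intro x
    have hfx : Measurable fun y => f (x - y) := hfm.comp (measurable_const.sub measurable_id)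
    rw [lintegral_add_left hfx,
      lintegral_sub_left_eq_self f x, lintegral_sub_right_eq_self f x, two_mul]
  have c2 : ∀ x, ∫⁻ y, (f (y - x) + f (x - y)) = 2 * ∫⁻ z, f z := by
    intro x
    rw [← c1 x]; simp only [add_comm]
  have i1 : ∫⁻ x, ∫⁻ y, (f (x - y) + f (y - x)) * ‖g x‖ₑ ^ 2 = (2 * ∫⁻ z, f z) * ∫⁻ x, ‖g x‖ₑ ^ 2 := by
    rw [← lintegral_const_mul _ (hg.enorm.pow_const 2)]
    refine lintegral_congr fun x => ?_
    rw [lintegral_mul_const' _ _ (by simp), c1]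
  have i2 : ∫⁻ x, ∫⁻ y, (f (x - y) + f (y - x)) * ‖g y‖ₑ ^ 2 = (2 * ∫⁻ z, f z) * ∫⁻ x, ‖g x‖ₑ ^ 2 := by
    rw [lintegral_lintegral_swap hm2.aemeasurable, ← lintegral_const_mul _ (hg.enorm.pow_const 2)]
    refine lintegral_congr fun x => ?_
    rw [lintegral_mul_const' _ _ (by simp), c2]
  have hfinal : (2 * ∫⁻ z, f z) * ∫⁻ x, ‖g x‖ₑ ^ 2 < ⊤ :=
    ENNReal.mul_lt_top (ENNReal.mul_lt_top (by simp) hff) hg2f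
  calc _ ≤ ∫⁻ x, ((∫⁻ y, (f (x - y) + f (y - x)) * ‖g x‖ₑ ^ 2) +
        ∫⁻ y, (f (x - y) + f (y - x)) * ‖g y‖ₑ ^ 2) := by
        refine lintegral_mono fun x => ?_
        have hmx : Measurable fun y => (f (x - y) + f (y - x)) * ‖g x‖ₑ ^ 2 :=
          hm1.comp (measurable_const.prodMk measurable_id)
        rw [← lintegral_add_left hmx]
        exact lintegral_mono fun y => hle x y
    _ = (2 * ∫⁻ z, f z) * (∫⁻ x, ‖g x‖ₑ ^ 2) + (2 * ∫⁻ z, f z) * ∫⁻ x, ‖g x‖ₑ ^ 2 := by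
        rw [lintegral_add_left hm1.lintegral_prod_right', i1, i2]
    _ < ⊤ := ENNReal.add_lt_top.2 ⟨hfinal, hfinal⟩

lemma extn_Q {γ : ℝ} (h0 : 1 / 2 < γ) (h1 : γ < 1) {g : ℝ → ℝ} (hg : Measurable g)
    (hgs : ∀ s, s ∉ Ioo (0:ℝ) 1 → g s = 0) (hg2 : Integrable fun t => g t ^ 2) :
    ∫⁻ x, ∫⁻ y, ENNReal.ofReal (|x - y| ^ (1 - 2 * γ)) * (‖extn γ g x‖ₑ * ‖extn γ g y‖ₑ) < ⊤ := by
  have hB := bet_pos h1 (show 0 < γ by linarith) (show 1 < γ + γ by linarith)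
  have t1 := quad_tonelli volume (ker γ) (ker_meas γ) (ker_nonneg γ)
    (fun x y => |x - y| ^ (1 - 2 * γ)) (bet γ γ) hB.le (ker_pair h0 h1) g hg
  have t2 := quad_tonelli volume (ker γ) (ker_meas γ) (ker_nonneg γ)
    (fun x y => |x - y| ^ (1 - 2 * γ)) (bet γ γ) hB.le (ker_pair h0 h1) (extn γ g) (extn_meas γ hg)
  have t3 : ∫⁻ w, (∫⁻ x, ENNReal.ofReal (ker γ w x) * ‖extn γ g x‖ₑ) ^ 2 ≤
      4 * ∫⁻ w, (∫⁻ x, ENNReal.ofReal (ker γ w x) * ‖g x‖ₑ) ^ 2 := by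
    rw [← lintegral_const_mul' _ _ (by simp)]
    refine lintegral_mono fun u => ?_
    calc _ ≤ (2 * ∫⁻ x, ENNReal.ofReal (ker γ u x) * ‖g x‖ₑ) ^ 2 := by
          gcongr
          exact extn_dom h0 h1 hg hgs u
      _ = _ := by rw [mul_pow]; norm_num
  rw [t1, t2] at t3
  have hfin : ENNReal.ofReal (bet γ γ) * ∫⁻ x, ∫⁻ y, ENNReal.ofReal (|x - y| ^ (1 - 2 * γ)) *
      (‖extn γ g x‖ₑ * ‖extn γ g y‖ₑ) < ⊤ :=
    t3.trans_lt (ENNReal.mul_lt_top (by simp)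
      (ENNReal.mul_lt_top ENNReal.ofReal_lt_top (Q_fin h0 h1 hg hgs hg2)))
  exact ENNReal.lt_top_of_mul_ne_top_right hfin.ne (by simpa using hB)

lemma frac_conv (e : ℝ) (v' : ℝ → ℝ) {t : ℝ} (ht : t ∈ Ioo (0:ℝ) 1) :
    ∫ s in (0:ℝ)..t, (t - s) ^ e * v' s =
      ∫ s, (if s < t then (t - s) ^ e else 0) * (Ioo (0:ℝ) 1).indicator v' s := by
  rw [intervalIntegral.integral_of_le ht.1.le, integral_Ioc_eq_integral_Ioo,
    ← integral_indicator measurableSet_Ioo]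
  refine integral_congr_ae (Filter.Eventually.of_forall fun s => ?_)
  simp only
  by_cases h1 : s < t
  · by_cases h2 : 0 < s
    · rw [indicator_of_mem (show s ∈ Ioo 0 t from ⟨h2, h1⟩), if_pos h1,
        indicator_of_mem (show s ∈ Ioo (0:ℝ) 1 from ⟨h2, h1.trans ht.2⟩)]
    · rw [indicator_of_notMem (fun h => h2 h.1), indicator_of_notMem (fun h => h2 h.1), mul_zero]
  · rw [indicator_of_notMem (fun h => h1 h.2), if_neg h1, zero_mul]

lemma frac_ker (γ : ℝ) (v' : ℝ → ℝ) {t : ℝ} (ht : t ∈ Ioo (0:ℝ) 1) :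
    leftFracInt (1 - γ) v' t =
      (Real.Gamma (1 - γ))⁻¹ * ∫ s, ker γ t s * (Ioo (0:ℝ) 1).indicator v' s := by
  rw [leftFracInt, frac_conv _ _ ht, show 1 - γ - 1 = -γ by ring]
  rfl

lemma extn_ker {γ : ℝ} (g : ℝ → ℝ) {t : ℝ} (ht : t ≤ 1) :
    ∫ s, ker γ t s * extn γ g s = ∫ s, ker γ t s * g s := by
  refine integral_congr_ae (Filter.Eventually.of_forall fun s => ?_)
  simp only
  by_cases hs : s < t
  · rw [extn, indicator_of_notMem (s := Ioi 1) (fun h : 1 < s => by linarith), add_zero]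
  · rw [ker, if_neg hs]; simp

lemma ker_zero {γ : ℝ} {g : ℝ → ℝ} (hgs : ∀ s, s ∉ Ioo (0:ℝ) 1 → g s = 0) {t : ℝ} (ht : t ≤ 0) :
    ∫ s, ker γ t s * g s = 0 := by
  rw [← integral_zero ℝ ℝ (μ := volume)]
  refine integral_congr_ae (Filter.Eventually.of_forall fun s => ?_)
  simp only
  by_cases hs : s < t
  · rw [hgs s (fun h => by linarith [h.1]), mul_zero]
  · rw [ker, if_neg hs, zero_mul]

/-- The key identity. -/
lemma key_id {γ : ℝ} (h0 : 1 / 2 < γ) (h1 : γ < 1) {g : ℝ → ℝ} (hg : Measurable g)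
    (hgs : ∀ s, s ∉ Ioo (0:ℝ) 1 → g s = 0) (hg2 : Integrable fun t => g t ^ 2) :
    ∫ t in Ioo (0:ℝ) 1, (∫ s, ker γ t s * g s) ^ 2 =
      bet γ γ * ∫ z : ℝ × ℝ, |z.1 - z.2| ^ (1 - 2 * γ) * (extn γ g z.1 * extn γ g z.2) := by
  have hB := bet_pos h1 (show 0 < γ by linarith) (show 1 < γ + γ by linarith)
  have q := (quad_fubini volume (ker γ) (ker_meas γ) (ker_nonneg γ)
    (fun x y => |x - y| ^ (1 - 2 * γ)) (fun x y => Real.rpow_nonneg (abs_nonneg _) _)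
    (bet γ γ) hB.le (ker_pair h0 h1) (extn γ g) (extn_meas γ hg) (extn_Q h0 h1 hg hgs hg2)).2
  have t1 := quad_tonelli volume (ker γ) (ker_meas γ) (ker_nonneg γ)
    (fun x y => |x - y| ^ (1 - 2 * γ)) (bet γ γ) hB.le (ker_pair h0 h1) g hg
  have hae : ∀ᵐ u : ℝ, ∫⁻ t, ENNReal.ofReal (ker γ u t) * ‖g t‖ₑ < ⊤ := by
    have hm : Measurable fun p : ℝ × ℝ => ENNReal.ofReal (ker γ p.1 p.2) * ‖g p.2‖ₑ :=
      (ker_meas γ).ennreal_ofReal.mul (hg.comp measurable_snd).enorm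
    have := ae_lt_top (hm.lintegral_prod_right'.pow_const 2) (by
      rw [t1]
      exact (ENNReal.mul_lt_top ENNReal.ofReal_lt_top (Q_fin h0 h1 hg hgs hg2)).ne)
    filter_upwards [this] with u hu
    simpa using hu
  rw [← q, ← integral_indicator measurableSet_Ioo]
  refine integral_congr_ae ?_
  have h1ne : ∀ᵐ u : ℝ, u ≠ 1 := by simp [ae_iff, measure_singleton]
  filter_upwards [hae, h1ne] with u hu hu1
  rcases lt_or_gt_of_ne hu1 with h | h
  · rw [extn_ker g h.le]
    by_cases hu0 : 0 < u
    · rw [indicator_of_mem (show u ∈ Ioo (0:ℝ) 1 from ⟨hu0, h⟩)]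
    · rw [indicator_of_notMem (fun h => hu0 h.1), ker_zero hgs (not_lt.1 hu0)]; simp
  · rw [indicator_of_notMem (fun h' => by linarith [h'.2]), extn_zero h0 h1 hg hgs h hu]; simp

lemma sym_id {γ : ℝ} (h0 : 1 / 2 < γ) (h1 : γ < 1) {v' : ℝ → ℝ} {g : ℝ → ℝ} (hg : Measurable g)
    (hgv : g = (Ioo (0:ℝ) 1).indicator v')
    (hgs : ∀ s, s ∉ Ioo (0:ℝ) 1 → g s = 0) (hg2 : Integrable fun t => g t ^ 2) :
    ∫ z : ℝ × ℝ, |z.1 - z.2| ^ (1 - 2 * γ) * (g z.1 * g z.2) =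
      2 * Real.Gamma (2 - 2 * γ) *
        ∫ t in Ioo (0:ℝ) 1, leftFracInt (2 - 2 * γ) v' t * v' t := by
  set H : ℝ × ℝ → ℝ := fun z => |z.1 - z.2| ^ (1 - 2 * γ) * (g z.1 * g z.2) with hH
  have hHm : Measurable H :=
    ((continuous_abs.measurable.comp (measurable_fst.sub measurable_snd)).pow_const _).mul
      ((hg.comp measurable_fst).mul (hg.comp measurable_snd))
  have hHi : Integrable H (volume.prod volume) := by
    refine ⟨hHm.aestronglyMeasurable, ?_⟩
    rw [hasFiniteIntegral_iff_enorm]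
    refine (lintegral_prod_le _).trans_lt (lt_of_le_of_lt (le_of_eq ?_) (Q_fin h0 h1 hg hgs hg2))
    refine lintegral_congr fun x => lintegral_congr fun y => ?_
    simp only [hH]
    rw [enorm_mul, enorm_mul, Real.enorm_of_nonneg (Real.rpow_nonneg (abs_nonneg _) _)]
  have hS : MeasurableSet {z : ℝ × ℝ | z.2 < z.1} := measurableSet_lt measurable_snd measurable_fst
  set H1 := {z : ℝ × ℝ | z.2 < z.1}.indicator H with hH1
  have hH1i : Integrable H1 (volume.prod volume) := hHi.indicator hS
  have hdec : ∀ z, H z = H1 z + H1 z.swap := by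
    rintro ⟨x, y⟩
    simp only [hH1, indicator, Set.mem_ofPred_eq, Prod.swap, hH]
    rcases lt_trichotomy x y with h | h | h
    · rw [if_neg (by linarith), if_pos h, abs_sub_comm]; ring
    · subst h
      rw [sub_self, abs_zero, Real.zero_rpow (by linarith)]; simp
    · rw [if_pos h, if_neg (by linarith)]; ring
  have hG : 0 < Real.Gamma (2 - 2 * γ) := Real.Gamma_pos_of_pos (by linarith)
  rw [Measure.volume_eq_prod]
  have hsi : Integrable (fun z : ℝ × ℝ => H1 z.swap) (volume.prod volume) := hH1i.swap
  rw [integral_congr_ae (Filter.Eventually.of_forall hdec), integral_add hH1i hsi]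
  have hsw : ∫ z : ℝ × ℝ, H1 z.swap ∂(volume.prod volume) = ∫ z, H1 z ∂(volume.prod volume) :=
    integral_prod_swap H1
  rw [hsw, integral_prod _ hH1i, ← two_mul, mul_assoc]
  congr 1
  rw [← integral_const_mul, ← integral_indicator measurableSet_Ioo]
  refine integral_congr_ae (Filter.Eventually.of_forall fun t => ?_)
  simp only
  by_cases ht : t ∈ Ioo (0:ℝ) 1
  · rw [indicator_of_mem ht, leftFracInt, frac_conv _ _ ht, ← hgv]
    have hgt : v' t = g t := by rw [hgv, indicator_of_mem ht]
    rw [hgt, show ∀ a b : ℝ, Real.Gamma (2 - 2 * γ) * ((Real.Gamma (2 - 2 * γ))⁻¹ * a * b) = a * b from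
      fun a b => by rw [mul_assoc, mul_inv_cancel_left₀ hG.ne'], ← integral_mul_const]
    refine integral_congr_ae (Filter.Eventually.of_forall fun s => ?_)
    simp only [hH1, indicator, Set.mem_ofPred_eq, hH]
    by_cases hs : s < t
    · rw [if_pos hs, if_pos hs, abs_of_pos (by linarith), show 2 - 2 * γ - 1 = 1 - 2 * γ by ring]; ring
    · rw [if_neg hs, if_neg hs]; simp
  · rw [indicator_of_notMem ht]
    simp [hH1, indicator, hH, hgs t ht]

lemma seg_val {γ : ℝ} {v v' : ℝ → ℝ} (hi : IntervalIntegrable v' volume 0 1)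
    (hv : ∀ t ∈ Icc (0 : ℝ) 1, v t = ∫ s in (0 : ℝ)..t, v' s) {p q : ℝ} (hq : q ∈ Ioo (0:ℝ) 1)
    (hpq : p < q) :
    ∫ x, seg γ (p, q) x * extn γ ((Ioo (0:ℝ) 1).indicator v') x =
      (q - p) ^ (-(1 + 2 * γ) / 2) * (v q - v (max p 0)) := by
  have hm : max p 0 < q := max_lt hpq hq.1
  have hm0 : 0 ≤ max p 0 := le_max_right _ _
  have sub : ∀ a ∈ Icc (0:ℝ) 1, IntervalIntegrable v' volume 0 a := fun a ha =>
    hi.mono_set (by rw [uIcc_of_le ha.1, uIcc_of_le zero_le_one]; exact Icc_subset_Icc le_rfl ha.2)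
  have hqI : q ∈ Icc (0:ℝ) 1 := ⟨hq.1.le, hq.2.le⟩
  have hpI : max p 0 ∈ Icc (0:ℝ) 1 := ⟨hm0, by linarith [hq.2]⟩
  rw [hv q hqI, hv _ hpI, intervalIntegral.integral_interval_sub_left (sub q hqI) (sub _ hpI),
    intervalIntegral.integral_of_le hm.le, integral_Ioc_eq_integral_Ioo, ← integral_const_mul,
    ← integral_indicator measurableSet_Ioo]
  refine integral_congr_ae (Filter.Eventually.of_forall fun x => ?_)
  simp only
  by_cases hx : p < x ∧ x < q
  · have hx1 : x < 1 := hx.2.trans hq.2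
    rw [seg, if_pos hx, extn, indicator_of_notMem (s := Ioi 1) (fun h : 1 < x => by linarith), add_zero]
    by_cases hx0 : 0 < x
    · rw [indicator_of_mem (show x ∈ Ioo (0:ℝ) 1 from ⟨hx0, hx1⟩),
        indicator_of_mem (show x ∈ Ioo (max p 0) q from ⟨max_lt hx.1 hx0, hx.2⟩)]
    · rw [indicator_of_notMem (fun h => hx0 h.1),
        indicator_of_notMem (fun h => hx0 (hm0.trans_lt h.1)), mul_zero]
  · rw [seg, if_neg hx, zero_mul, indicator_of_notMem]
    exact fun h => hx ⟨(le_max_left _ _).trans_lt h.1, h.2⟩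

lemma seg_zero {γ : ℝ} (G : ℝ → ℝ) {p q : ℝ} (hpq : q ≤ p) :
    ∫ x, seg γ (p, q) x * G x = 0 := by
  rw [← integral_zero ℝ ℝ (μ := volume)]
  refine integral_congr_ae (Filter.Eventually.of_forall fun x => ?_)
  simp only
  rw [seg, if_neg (fun h => by linarith [h.1, h.2]), zero_mul]

lemma half_sq {γ d a : ℝ} (hd : 0 < d) :
    (d ^ (-(1 + 2 * γ) / 2) * a) ^ 2 = a ^ 2 / d ^ (1 + 2 * γ) := by
  have : (d ^ (-(1 + 2 * γ) / 2)) ^ 2 = (d ^ (1 + 2 * γ))⁻¹ := by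
    rw [← Real.rpow_natCast, ← Real.rpow_mul hd.le, ← Real.rpow_neg hd.le]
    congr 1; push_cast; ring
  rw [mul_pow, this]; ring

lemma sob_le {γ : ℝ} (h0 : 1 / 2 < γ) (h1 : γ < 1) {v v' : ℝ → ℝ}
    (hi : IntervalIntegrable v' volume 0 1)
    (hv : ∀ t ∈ Icc (0 : ℝ) 1, v t = ∫ s in (0 : ℝ)..t, v' s)
    (hF : Integrable fun w : ℝ × ℝ =>
      (∫ x, seg γ w x * extn γ ((Ioo (0:ℝ) 1).indicator v') x) ^ 2) :
    (∫ s in Ioo (0 : ℝ) 1, (v s) ^ 2) + (gagliardoSemi γ v) ^ 2 ≤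
      (2 ^ (1 + 2 * γ) + 2) * ∫ w : ℝ × ℝ,
        (∫ x, seg γ w x * extn γ ((Ioo (0:ℝ) 1).indicator v') x) ^ 2 := by
  set F : ℝ × ℝ → ℝ := fun w =>
    (∫ x, seg γ w x * extn γ ((Ioo (0:ℝ) 1).indicator v') x) ^ 2 with hFd
  have hF0 : ∀ w, 0 ≤ F w := fun w => sq_nonneg _
  have hv0 : v 0 = 0 := by rw [hv 0 ⟨le_rfl, zero_le_one⟩]; simp
  have h2 : (0:ℝ) < 2 ^ (1 + 2 * γ) := by positivity
  rw [Measure.volume_eq_prod] at hF ⊢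
  -- the L² part
  have p1 : ∫ s in Ioo (0 : ℝ) 1, (v s) ^ 2 ≤ 2 ^ (1 + 2 * γ) * ∫ w, F w ∂(volume.prod volume) := by
    have e1 := setIntegral_prod_mul (μ := volume) (ν := volume) (fun _ : ℝ => (1:ℝ))
      (fun q => v q ^ 2) (Ioo (-1:ℝ) 0) (Ioo (0:ℝ) 1)
    have e2 : ∫ x in Ioo (-1:ℝ) 0, (1:ℝ) = 1 := by simp
    rw [e2, one_mul] at e1
    rw [← e1, ← integral_const_mul]
    refine le_trans ?_ (setIntegral_le_integral (s := Ioo (-1:ℝ) 0 ×ˢ Ioo (0:ℝ) 1) (hF.const_mul _)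
      (Filter.Eventually.of_forall fun w => mul_nonneg h2.le (hF0 w)))
    refine integral_mono_of_nonneg (Filter.Eventually.of_forall fun w => by
      simp only [one_mul]; exact sq_nonneg _) (hF.const_mul _).integrableOn ?_
    filter_upwards [ae_restrict_mem (measurableSet_Ioo.prod measurableSet_Ioo)] with w hw
    obtain ⟨⟨hp1, hp0⟩, hq⟩ := hw
    simp only [one_mul]
    have hpq : w.1 < w.2 := hp0.trans hq.1
    have : F w = v w.2 ^ 2 / (w.2 - w.1) ^ (1 + 2 * γ) := by
      have := seg_val (γ := γ) hi hv hq hpq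
      simp only [hFd]
      rw [show w = (w.1, w.2) from rfl, this, half_sq (by simp; linarith), max_eq_right hp0.le, hv0, sub_zero]
    have hd : 0 < w.2 - w.1 := by linarith
    rw [this, mul_div_assoc', le_div_iff₀ (by positivity), mul_comm]
    have : (w.2 - w.1) ^ (1 + 2 * γ) ≤ 2 ^ (1 + 2 * γ) :=
      Real.rpow_le_rpow hd.le (by linarith [hq.2]) (by linarith)
    exact mul_le_mul_of_nonneg_right this (sq_nonneg _)
  have p2 : gagliardoSemi γ v ^ 2 ≤ 2 * ∫ w, F w ∂(volume.prod volume) := by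
    have hFs : Integrable (fun w : ℝ × ℝ => F w + F w.swap) (volume.prod volume) := hF.add hF.swap
    have e0 : ∀ s ∈ Ioo (0:ℝ) 1, ∀ t ∈ Ioo (0:ℝ) 1,
        (v s - v t) ^ 2 / |s - t| ^ (1 + 2 * γ) = F (s, t) + F (t, s) := by
      intro s hs t ht
      simp only [hFd]
      rcases lt_trichotomy s t with h | h | h
      · rw [seg_val hi hv ht h, seg_zero _ h.le, half_sq (by linarith), max_eq_left hs.1.le,
          abs_sub_comm, abs_of_pos (by linarith)]
        ring
      · subst h; rw [seg_zero _ le_rfl]; simp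
      · rw [seg_val hi hv hs h, seg_zero _ h.le, half_sq (by linarith), max_eq_left ht.1.le,
          abs_of_pos (by linarith)]
        ring
    have e1 : ∫ s in Ioo (0 : ℝ) 1, ∫ t in Ioo (0 : ℝ) 1, (v s - v t) ^ 2 / |s - t| ^ (1 + 2 * γ) =
        ∫ w in Ioo (0:ℝ) 1 ×ˢ Ioo (0:ℝ) 1, (F w + F w.swap) ∂(volume.prod volume) := by
      rw [setIntegral_prod _ hFs.integrableOn]
      refine setIntegral_congr_fun measurableSet_Ioo fun s hs => ?_
      exact setIntegral_congr_fun measurableSet_Ioo fun t ht => e0 s hs t ht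
    have n1 : 0 ≤ ∫ w in Ioo (0:ℝ) 1 ×ˢ Ioo (0:ℝ) 1, (F w + F w.swap) ∂(volume.prod volume) :=
      integral_nonneg fun w => add_nonneg (hF0 _) (hF0 _)
    rw [gagliardoSemi, e1, Real.sq_sqrt n1]
    refine (setIntegral_le_integral hFs
      (Filter.Eventually.of_forall fun w => add_nonneg (hF0 _) (hF0 _))).trans ?_
    have hsw : ∫ z : ℝ × ℝ, F z.swap ∂(volume.prod volume) = ∫ z, F z ∂(volume.prod volume) :=
      integral_prod_swap F
    have hFsw : Integrable (fun z : ℝ × ℝ => F z.swap) (volume.prod volume) := hF.swap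
    rw [integral_add hF hFsw, hsw, two_mul]
  linarith

theorem stmt_5 (γ : ℝ) (hγ1 : 1 / 2 < γ) (hγ2 : γ < 1) :
    ∃ c C : ℝ, 0 < c ∧ 0 < C ∧ ∀ v v' : ℝ → ℝ, Measurable v' →
      IntegrableOn (fun t => (v' t) ^ 2) (Set.Ioo 0 1) →
      (∀ t ∈ Set.Icc (0 : ℝ) 1, v t = ∫ s in (0 : ℝ)..t, v' s) →
      c * sobNorm γ v ≤
          Real.sqrt (∫ t in Set.Ioo (0 : ℝ) 1, (leftFracInt (1 - γ) v' t) ^ 2) ∧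
        (∫ t in Set.Ioo (0 : ℝ) 1, (leftFracInt (1 - γ) v' t) ^ 2) ≤
          C * ∫ t in Set.Ioo (0 : ℝ) 1, leftFracInt (2 - 2 * γ) v' t * v' t := by
  have hB := bet_pos hγ2 (show 0 < γ by linarith) (show 1 < γ + γ by linarith)
  have hG1 : 0 < Real.Gamma (1 - γ) := Real.Gamma_pos_of_pos (by linarith)
  have hG2 : 0 < Real.Gamma (2 - 2 * γ) := Real.Gamma_pos_of_pos (by linarith)
  have hc2 : 0 < (2 * γ * (2 * γ - 1))⁻¹ := by
    have : 0 < 2 * γ - 1 := by linarith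
    positivity
  set M : ℝ := (2 ^ (1 + 2 * γ) + 2) * ((2 * γ * (2 * γ - 1))⁻¹ *
    ((bet γ γ)⁻¹ * Real.Gamma (1 - γ) ^ 2)) with hM
  have hMp : 0 < M := by positivity
  refine ⟨(Real.sqrt M)⁻¹, (Real.Gamma (1 - γ))⁻¹ ^ 2 * (bet γ γ * (2 * Real.Gamma (2 - 2 * γ))),
    by positivity, by positivity, ?_⟩
  intro v v' hm hi2 hv
  set g := (Ioo (0:ℝ) 1).indicator v' with hgd
  have hg : Measurable g := hm.indicator measurableSet_Ioo
  have hgs : ∀ s, s ∉ Ioo (0:ℝ) 1 → g s = 0 := fun s hs => indicator_of_notMem hs _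
  have hg2 : Integrable fun t => g t ^ 2 := by
    have : (fun t => g t ^ 2) = (Ioo (0:ℝ) 1).indicator (fun t => v' t ^ 2) := by
      ext t
      by_cases ht : t ∈ Ioo (0:ℝ) 1
      · rw [hgd, indicator_of_mem ht, indicator_of_mem ht]
      · rw [hgd, indicator_of_notMem ht, indicator_of_notMem ht]; simp
    rw [this]
    exact hi2.integrable_indicator measurableSet_Ioo
  have hi : IntervalIntegrable v' volume 0 1 := by
    rw [intervalIntegrable_iff_integrableOn_Ioo_of_le zero_le_one]
    have hone : IntegrableOn (fun _ : ℝ => (1:ℝ)) (Ioo 0 1) := integrableOn_const (by simp)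
    refine Integrable.mono' (hone.add hi2) hm.aestronglyMeasurable ?_
    refine Filter.Eventually.of_forall fun t => ?_
    simp only [Pi.add_apply, Real.norm_eq_abs]
    nlinarith [sq_abs (v' t), sq_nonneg (|v' t| - 1), abs_nonneg (v' t)]
  set W := ∫ t in Ioo (0 : ℝ) 1, (leftFracInt (1 - γ) v' t) ^ 2 with hW
  have hWX : W = (Real.Gamma (1 - γ))⁻¹ ^ 2 * ∫ t in Ioo (0:ℝ) 1, (∫ s, ker γ t s * g s) ^ 2 := by
    rw [hW, ← integral_const_mul]
    refine setIntegral_congr_fun measurableSet_Ioo fun t ht => ?_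
    show leftFracInt (1 - γ) v' t ^ 2 = _
    rw [frac_ker γ v' ht, mul_pow]
  constructor
  · obtain ⟨sI, sE⟩ := quad_fubini volume (seg γ) (seg_meas γ) (seg_nonneg γ)
      (fun x y => |x - y| ^ (1 - 2 * γ)) (fun x y => Real.rpow_nonneg (abs_nonneg _) _)
      _ hc2.le (seg_pair hγ1) (extn γ g) (extn_meas γ hg) (extn_Q hγ1 hγ2 hg hgs hg2)
    have hle := sob_le hγ1 hγ2 hi hv sI
    rw [← hgd, sE] at hle
    have hk := key_id hγ1 hγ2 hg hgs hg2
    rw [hk] at hWX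
    set J := ∫ z : ℝ × ℝ, |z.1 - z.2| ^ (1 - 2 * γ) * (extn γ g z.1 * extn γ g z.2)
    have hJ : (2 ^ (1 + 2 * γ) + 2) * ((2 * γ * (2 * γ - 1))⁻¹ * J) = M * W := by
      have : J = (bet γ γ)⁻¹ * Real.Gamma (1 - γ) ^ 2 * W := by
        rw [hWX]; field_simp
      rw [hM]
      rw [this]; ring
    rw [hJ] at hle
    rw [sobNorm, inv_mul_le_iff₀ (by positivity), ← Real.sqrt_mul hMp.le]
    exact Real.sqrt_le_sqrt hle
  · obtain ⟨kI, kE⟩ := quad_fubini volume (ker γ) (ker_meas γ) (ker_nonneg γ)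
      (fun x y => |x - y| ^ (1 - 2 * γ)) (fun x y => Real.rpow_nonneg (abs_nonneg _) _)
      _ hB.le (ker_pair hγ1 hγ2) g hg (Q_fin hγ1 hγ2 hg hgs hg2)
    rw [sym_id hγ1 hγ2 hg hgd hgs hg2] at kE
    have hle := setIntegral_le_integral (s := Ioo (0:ℝ) 1) kI
      (Filter.Eventually.of_forall fun w => sq_nonneg _)
    rw [kE] at hle
    rw [hWX]
    calc _ ≤ (Real.Gamma (1 - γ))⁻¹ ^ 2 * _ := mul_le_mul_of_nonneg_left hle (by positivity)
      _ = _ := by ring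
end
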